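/- arXiv:1707.01315 — 2 statements merged into one kernel-verified Lean document; each statement's English description precedes it below -/
import Mathlib

section
/- Circle method upper bound for averaged correlations: There is an absolute constant C such that the following holds. Let H ≥ 1, let f, g : ℤ → ℂ be finitely supported, let 𝔐 be a measurable subset of ℝ/ℤ and 𝔪 := (ℝ/ℤ) ∖ 𝔐, and for each integer h set MT_{𝔐,h} := ∫_{𝔐} S_f(α) · conj(S_g(α)) · e(αh) dα. Then for any integer h₀, ∑_{h ∈ ℤ, |h−h₀| ≤ H} |∑_{n∈ℤ} f(n)·conj(g(n+h)) − MT_{𝔐,h}|² ≤ C · H · ∫_{𝔪} |S_f(α)| |S_g(α)| ( ∫_{𝔪 ∩ [α − 1/(2H), α + 1/(2H)]} |S_f(β)| |S_g(β)| dβ ) dα. -/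
open scoped BigOperators
open Real MeasureTheory

/-- The exponential sum `S_f(α) = ∑_{n ∈ ℤ} f(n) e(αn)` on the circle `ℝ/ℤ`. -/
noncomputable def circleExpSum (f : ℤ → ℂ) (α : AddCircle (1 : ℝ)) : ℂ :=
  ∑ᶠ n : ℤ, f n * fourier n α

theorem measurable_setIntegral_closedBall {X E : Type*} [PseudoMetricSpace X]
    [SecondCountableTopology X] [MeasurableSpace X] [BorelSpace X] [NormedAddCommGroup E]
    [NormedSpace ℝ E] [MeasurableSpace E] [BorelSpace E] [SecondCountableTopology E]
    (μ : Measure X) [SFinite μ] {u : X → E} (hu : Measurable u) (r : ℝ) :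
    Measurable fun t => ∫ α in Metric.closedBall t r, u α ∂μ := by
  have h : StronglyMeasurable
      (fun p : X × X => (Metric.closedBall p.1 r).indicator u p.2) := by
    have hs : MeasurableSet {p : X × X | dist p.2 p.1 ≤ r} :=
      measurableSet_le (measurable_snd.dist measurable_fst) measurable_const
    convert ((hu.comp measurable_snd).indicator hs).stronglyMeasurable using 1
    classical
    ext p
    simp [Set.indicator_apply]
  have h' : StronglyMeasurable
      (Function.uncurry fun t α => (Metric.closedBall t r).indicator u α) := h
  simpa only [integral_indicator Metric.isClosed_closedBall.measurableSet] using
    (h'.integral_prod_right (ν := μ)).measurable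

theorem integral_sq_setIntegral_closedBall_le {X : Type*} [PseudoMetricSpace X]
    [SecondCountableTopology X] [MeasurableSpace X] [BorelSpace X]
    (μ : Measure X) [IsFiniteMeasure μ] {u : X → ℝ} (hu : Measurable u) (hu0 : ∀ x, 0 ≤ u x)
    {M : ℝ} (huM : ∀ x, u x ≤ M) {r V : ℝ} (hV : ∀ x, μ.real (Metric.closedBall x r) ≤ V) :
    ∫ t, (∫ α in Metric.closedBall t r, u α ∂μ) ^ 2 ∂μ ≤
      V * ∫ α, u α * (∫ β in Metric.closedBall α (2 * r), u β ∂μ) ∂μ := by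
  classical
  set K : X → X → ℝ := fun a b => if dist a b ≤ r then 1 else 0 with hK
  have hK0 : ∀ a b, 0 ≤ K a b := fun a b => by simp only [hK]; split_ifs <;> norm_num
  have hK1 : ∀ a b, K a b ≤ 1 := fun a b => by simp only [hK]; split_ifs <;> norm_num
  have hKm : Measurable (fun p : X × X => K p.1 p.2) :=
    Measurable.ite (measurableSet_le (measurable_fst.dist measurable_snd) measurable_const)
      measurable_const measurable_const
  have hball : ∀ (s : ℝ) (t : X), MeasurableSet (Metric.closedBall t s) :=
    fun s t => Metric.isClosed_closedBall.measurableSet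
  have hind : ∀ (t : X) (v : X → ℝ),
      ∫ α in Metric.closedBall t r, v α ∂μ = ∫ α, K α t * v α ∂μ := fun t v => by
    rw [← integral_indicator (hball r t)]
    refine integral_congr_ae (.of_forall fun α => ?_)
    simp [hK, Set.indicator_apply]
  have hM : ∀ x : X, 0 ≤ M := fun x => (hu0 x).trans (huM x)
  have hui : Integrable u μ := Integrable.of_bound hu.aestronglyMeasurable M
    (.of_forall fun x => by rw [Real.norm_of_nonneg (hu0 x)]; exact huM x)
  set g : X → ℝ := fun t => ∫ α, K α t * u α ∂μ with hg
  have hgm : Measurable g := by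
    have : StronglyMeasurable (fun p : X × X => K p.2 p.1 * u p.2) :=
      ((hKm.comp measurable_swap).mul (hu.comp measurable_snd)).stronglyMeasurable
    exact this.integral_prod_right.measurable
  have hg0 : ∀ t, 0 ≤ g t := fun t =>
    integral_nonneg fun α => mul_nonneg (hK0 _ _) (hu0 _)
  have hgM : ∀ t, g t ≤ ∫ α, u α ∂μ := fun t =>
    integral_mono_of_nonneg (.of_forall fun α => mul_nonneg (hK0 _ _) (hu0 _)) hui
      (.of_forall fun α => mul_le_of_le_one_left (hu0 _) (hK1 _ _))
  have hswap : ∫ t, g t ^ 2 ∂μ = ∫ α, u α * ∫ t, K α t * g t ∂μ ∂μ := by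
    have h1 : ∀ t, g t ^ 2 = ∫ α, K α t * u α * g t ∂μ := fun t => by
      rw [integral_mul_const, sq]
    simp_rw [h1]
    rw [integral_integral_swap]
    · simp_rw [← integral_const_mul]
      refine integral_congr_ae (.of_forall fun α => integral_congr_ae (.of_forall fun t => ?_))
      simp only; ring
    · refine Integrable.of_bound (C := 1 * M * ∫ α, u α ∂μ) ?_ (.of_forall fun p => ?_)
      · exact (((hKm.comp measurable_swap).mul (hu.comp measurable_snd)).mul
          (hgm.comp measurable_fst)).aestronglyMeasurable
      · have := hK0 p.2 p.1; have := hu0 p.2; have := hg0 p.1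
        have := hM p.1
        rw [Function.uncurry, Real.norm_of_nonneg (by positivity)]
        gcongr
        · exact hK1 _ _
        · exact huM _
        · exact hgM _
  have hinner : ∀ α, ∫ t, K α t * g t ∂μ ≤
      V * ∫ β in Metric.closedBall α (2 * r), u β ∂μ := fun α => by
    simp_rw [hg, ← integral_const_mul]
    rw [integral_integral_swap, ← integral_indicator (hball (2 * r) α)]
    · refine integral_mono_of_nonneg (.of_forall fun β => integral_nonneg fun t =>
        mul_nonneg (hK0 _ _) (mul_nonneg (hK0 _ _) (hu0 _)))
        ((hui.const_mul V).indicator (hball _ _)) (.of_forall fun β => ?_)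
      simp only [Set.indicator_apply, Metric.mem_closedBall]
      split_ifs with h
      · calc ∫ t, K α t * (K β t * u β) ∂μ
            ≤ ∫ t in Metric.closedBall α r, u β ∂μ := by
              rw [hind]
              refine integral_mono_of_nonneg (.of_forall fun t =>
                mul_nonneg (hK0 _ _) (mul_nonneg (hK0 _ _) (hu0 _))) ?_
                (.of_forall fun t => ?_)
              · refine Integrable.of_bound (C := 1 * M) ?_ (.of_forall fun t => ?_)
                · exact ((hKm.comp (measurable_id.prodMk measurable_const)).mul
                    measurable_const).aestronglyMeasurable
                · have := hK0 t α; have := hu0 β; have := hM t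
                  rw [Real.norm_of_nonneg (by positivity)]
                  gcongr
                  · exact hK1 _ _
                  · exact huM _
              · have : K α t = K t α := by simp only [hK, dist_comm]
                simp only [this]
                exact mul_le_mul_of_nonneg_left
                  (mul_le_of_le_one_left (hu0 _) (hK1 _ _)) (hK0 _ _)
          _ = μ.real (Metric.closedBall α r) * u β := by simp
          _ ≤ V * u β := by gcongr; exacts [hu0 _, hV _]
      · refine le_of_eq (integral_eq_zero_of_ae (.of_forall fun t => ?_))
        simp only [hK, Pi.zero_apply]
        split_ifs with h1 h2
        · exact absurd ((dist_triangle_right β α t).trans (by linarith)) h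
        all_goals simp
    · refine Integrable.of_bound (C := 1 * (1 * M)) ?_ (.of_forall fun p => ?_)
      · exact ((hKm.comp (measurable_const.prodMk measurable_fst)).mul
          ((hKm.comp measurable_swap).mul (hu.comp measurable_snd))).aestronglyMeasurable
      · have := hK0 α p.1; have := hK0 p.2 p.1; have := hu0 p.2
        have := hM p.1
        rw [Function.uncurry, Real.norm_of_nonneg (by positivity)]
        gcongr
        · exact hK1 _ _
        · exact hK1 _ _
        · exact huM _
  simp_rw [hind]
  rw [hswap, ← integral_const_mul]
  have hUm := measurable_setIntegral_closedBall μ hu (2 * r)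
  refine integral_mono_of_nonneg (.of_forall fun α => mul_nonneg (hu0 _)
    (integral_nonneg fun t => mul_nonneg (hK0 _ _) (hg0 _))) ?_ (.of_forall fun α => ?_)
  · refine Integrable.const_mul (Integrable.of_bound (C := M * ∫ α, u α ∂μ)
      (hu.mul hUm).aestronglyMeasurable (.of_forall fun α => ?_)) V
    rw [Pi.mul_apply]
    have h1 : 0 ≤ ∫ β in Metric.closedBall α (2 * r), u β ∂μ :=
      integral_nonneg fun _ => hu0 _
    have := hM α
    rw [Real.norm_of_nonneg (mul_nonneg (hu0 _) h1)]
    exact mul_le_mul (huM α) (setIntegral_le_integral hui (.of_forall hu0)) h1 this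
  · simp only
    rw [mul_left_comm]
    exact mul_le_mul_of_nonneg_left (hinner α) (hu0 α)

theorem fourierCoeff_setIntegral_closedBall {φ : AddCircle (1 : ℝ) → ℂ} (hφ : Measurable φ)
    {M : ℝ} (hM : ∀ x, ‖φ x‖ ≤ M) (r : ℝ) (k : ℤ) :
    fourierCoeff (fun t => ∫ α in Metric.closedBall t r, φ α) k =
      fourierCoeff φ k * ∫ s in Metric.closedBall (0 : AddCircle (1 : ℝ)) r, fourier (-k) s := by
  have hball : ∀ t : AddCircle (1 : ℝ), MeasurableSet (Metric.closedBall t r) :=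
    fun t => Metric.isClosed_closedBall.measurableSet
  simp only [fourierCoeff, AddCircle.integral_haarAddCircle, inv_one, one_smul, smul_eq_mul]
  classical
  rw [← integral_mul_const]
  simp_rw [← integral_indicator (hball _), ← integral_const_mul]
  rw [integral_integral_swap]
  · refine integral_congr_ae (.of_forall fun α => ?_)
    simp only
    rw [← integral_add_right_eq_self _ α]
    refine integral_congr_ae (.of_forall fun s => ?_)
    have hd : dist α (s + α) = dist s 0 := by
      rw [dist_comm, dist_eq_norm, dist_eq_norm]; simp
    simp only [Set.indicator_apply, Metric.mem_closedBall, hd]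
    split_ifs
    · have : fourier (-k) (s + α) = fourier (-k) s * fourier (-k) α := by
        simp [fourier_apply, smul_add, AddCircle.toCircle_add]
      rw [this]; ring
    · simp
  · refine Integrable.of_bound (C := M) ?_ (.of_forall fun p => ?_)
    · refine Measurable.aestronglyMeasurable ?_
      have hs : MeasurableSet {p : AddCircle (1 : ℝ) × AddCircle (1 : ℝ) | dist p.2 p.1 ≤ r} :=
        measurableSet_le (measurable_snd.dist measurable_fst) measurable_const
      exact ((map_continuous (fourier (-k))).measurable.comp measurable_fst).mul
        ((hφ.comp measurable_snd).indicator hs)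
    · have h1 : ‖fourier (-k) p.1‖ = 1 := Circle.norm_coe _
      rw [Function.uncurry, norm_mul, h1, one_mul]
      exact (norm_indicator_le_norm_self _ _).trans (hM _)

theorem half_le_re_fourier {k : ℤ} {r : ℝ} (hkr : |(k : ℝ)| * r ≤ 1 / 6)
    {s : AddCircle (1 : ℝ)} (hs : s ∈ Metric.closedBall 0 r) :
    1 / 2 ≤ (fourier k s).re := by
  obtain ⟨x, rfl⟩ := QuotientAddGroup.mk_surjective s
  rw [mem_closedBall_zero_iff] at hs
  have hn : ‖(x : AddCircle (1 : ℝ))‖ = |x - round x| := by simp [AddCircle.norm_eq]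
  replace hs : |x - round x| ≤ r := hn ▸ hs
  have hx : ((x : ℝ) : AddCircle (1 : ℝ)) = ((x - round x : ℝ) : AddCircle (1 : ℝ)) := by
    rw [AddCircle.coe_sub, eq_comm, sub_eq_self]
    exact AddCircle.coe_eq_zero_iff _ |>.2 ⟨round x, by simp⟩
  change 1 / 2 ≤ (fourier k ((x : ℝ) : AddCircle (1 : ℝ))).re
  rw [hx, fourier_coe_apply]
  set y : ℝ := x - round x
  have he : 2 * (π : ℂ) * Complex.I * k * y / (1 : ℝ) = ((2 * π * (k * y) : ℝ) : ℂ) * Complex.I := by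
    push_cast; ring
  rw [he, Complex.exp_ofReal_mul_I_re, ← Real.cos_pi_div_three, ← Real.cos_abs (2 * π * (k * y))]
  have hky : |(k : ℝ) * y| ≤ 1 / 6 := by
    rw [abs_mul]; exact (mul_le_mul_of_nonneg_left hs (abs_nonneg _)).trans hkr
  refine Real.cos_le_cos_of_nonneg_of_le_pi (abs_nonneg _) (by linarith [Real.pi_pos]) ?_
  rw [abs_mul, abs_of_pos Real.two_pi_pos]
  nlinarith [Real.pi_pos]

theorem le_norm_setIntegral_fourier {k : ℤ} {r : ℝ} (hkr : |(k : ℝ)| * r ≤ 1 / 6)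
    (hr : 0 ≤ r) (hr' : 2 * r ≤ 1) :
    r ≤ ‖∫ s in Metric.closedBall (0 : AddCircle (1 : ℝ)) r, fourier k s‖ := by
  have hint : IntegrableOn (fun s => fourier k s) (Metric.closedBall (0 : AddCircle (1 : ℝ)) r) :=
    (map_continuous (fourier k)).continuousOn.integrableOn_compact (isCompact_closedBall _ _)
  refine le_trans ?_ (Complex.re_le_norm _)
  have h := integral_re hint
  simp only [RCLike.re_to_complex] at h
  rw [← h]
  calc r = ∫ s in Metric.closedBall (0 : AddCircle (1 : ℝ)) r, (1 / 2 : ℝ) := by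
        rw [setIntegral_const, measureReal_def, AddCircle.volume_closedBall, min_eq_right hr',
          ENNReal.toReal_ofReal (by positivity), smul_eq_mul]
        ring
    _ ≤ _ := setIntegral_mono_on (by simp) hint.re
        Metric.isClosed_closedBall.measurableSet fun s hs => half_le_re_fourier hkr hs

theorem hasSum_sq_fourierCoeff_of_memLp {G : AddCircle (1 : ℝ) → ℂ} (hG : MemLp G 2) :
    HasSum (fun k => ‖fourierCoeff G k‖ ^ 2) (∫ t, ‖G t‖ ^ 2) := by
  have h := hG.haarAddCircle
  have h2 := hasSum_sq_fourierCoeff h.toLp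
  have h3 : ∫ t, ‖h.toLp G t‖ ^ 2 ∂AddCircle.haarAddCircle = ∫ t, ‖G t‖ ^ 2 := by
    rw [integral_congr_ae (g := fun t => ‖G t‖ ^ 2)
      (h.coeFn_toLp.mono fun t ht => by simp only [ht]), AddCircle.integral_haarAddCircle]
    simp
  rw [h3, fourierCoeff_congr_ae h.coeFn_toLp] at h2
  exact h2

theorem sum_sq_fourierCoeff_le {φ : AddCircle (1 : ℝ) → ℂ} (hφ : Measurable φ)
    {M : ℝ} (hM : ∀ x, ‖φ x‖ ≤ M) {r : ℝ} (hr : 0 < r) (hr' : 2 * r ≤ 1)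
    (s : Finset ℤ) (hs : ∀ k ∈ s, |(k : ℝ)| * r ≤ 1 / 6) :
    ∑ k ∈ s, ‖fourierCoeff φ k‖ ^ 2 ≤
      2 / r * ∫ α, ‖φ α‖ * ∫ β in Metric.closedBall α (2 * r), ‖φ β‖ := by
  set G : AddCircle (1 : ℝ) → ℂ := fun t => ∫ α in Metric.closedBall t r, φ α with hG
  have hφi : Integrable φ := Integrable.of_bound hφ.aestronglyMeasurable M (.of_forall hM)
  have hGm : Measurable G := measurable_setIntegral_closedBall volume hφ r
  have hGle : ∀ t, ‖G t‖ ≤ ∫ α in Metric.closedBall t r, ‖φ α‖ := fun t =>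
    norm_integral_le_integral_norm _
  have hle : ∀ t, ∫ α in Metric.closedBall t r, ‖φ α‖ ≤ ∫ α, ‖φ α‖ := fun t =>
    setIntegral_le_integral hφi.norm (.of_forall fun _ => norm_nonneg _)
  have hGL : MemLp G 2 := MemLp.of_bound hGm.aestronglyMeasurable _
    (.of_forall fun t => (hGle t).trans (hle t))
  have hU := measurable_setIntegral_closedBall (volume : Measure (AddCircle (1 : ℝ))) hφ.norm r
  have h1 : ∑ k ∈ s, ‖fourierCoeff φ k‖ ^ 2 * r ^ 2 ≤ ∑ k ∈ s, ‖fourierCoeff G k‖ ^ 2 := by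
    refine Finset.sum_le_sum fun k hk => ?_
    rw [hG, fourierCoeff_setIntegral_closedBall hφ hM, norm_mul, mul_pow]
    gcongr
    exact le_norm_setIntegral_fourier (by simpa using hs k hk) hr.le hr'
  have h2 : ∑ k ∈ s, ‖fourierCoeff G k‖ ^ 2 ≤ ∫ t, ‖G t‖ ^ 2 :=
    sum_le_hasSum s (fun _ _ => by positivity) (hasSum_sq_fourierCoeff_of_memLp hGL)
  have h3 : ∫ t, ‖G t‖ ^ 2 ≤ ∫ t, (∫ α in Metric.closedBall t r, ‖φ α‖) ^ 2 := by
    refine integral_mono_of_nonneg (.of_forall fun t => by positivity) ?_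
      (.of_forall fun t => by have := hGle t; dsimp only; gcongr)
    refine Integrable.of_bound (C := (∫ α, ‖φ α‖) ^ 2) (hU.pow_const 2).aestronglyMeasurable
      (.of_forall fun t => ?_)
    have h0 : 0 ≤ ∫ α in Metric.closedBall t r, ‖φ α‖ := integral_nonneg fun _ => norm_nonneg _
    rw [Real.norm_of_nonneg (by positivity)]
    have := hle t
    gcongr
  have h4 := integral_sq_setIntegral_closedBall_le (volume : Measure (AddCircle (1 : ℝ)))
    hφ.norm (fun _ => norm_nonneg _) hM (r := r) (V := 2 * r) (fun x => by
      rw [measureReal_def, AddCircle.volume_closedBall, min_eq_right hr',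
        ENNReal.toReal_ofReal (by positivity)])
  have h5 := h1.trans (h2.trans (h3.trans h4))
  rw [← Finset.sum_mul] at h5
  rw [← mul_le_mul_iff_left₀ (by positivity : 0 < r ^ 2)]
  refine h5.trans (le_of_eq ?_)
  field_simp

theorem circleExpSum_eq_sum {f : ℤ → ℂ} (hf : f.support.Finite) (α : AddCircle (1 : ℝ)) :
    circleExpSum f α = ∑ n ∈ hf.toFinset, f n * fourier n α :=
  finsum_eq_sum_of_support_subset _ fun n hn => by
    simpa using left_ne_zero_of_mul (Function.mem_support.1 hn)

theorem continuous_circleExpSum {f : ℤ → ℂ} (hf : f.support.Finite) :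
    Continuous (circleExpSum f) := by
  rw [funext (circleExpSum_eq_sum hf)]
  exact continuous_finsetSum _ fun n _ => continuous_const.mul (map_continuous (fourier n))

theorem integral_fourier_eq_ite (n : ℤ) :
    ∫ α : AddCircle (1 : ℝ), (fourier n α : ℂ) = if n = 0 then 1 else 0 := by
  have h := congrFun (fourierCoeff_fourier (T := 1) n) 0
  simp only [fourierCoeff, AddCircle.integral_haarAddCircle, inv_one, one_smul, smul_eq_mul,
    neg_zero, fourier_zero, one_mul] at h
  rw [h, Pi.single_apply]
  simp only [eq_comm]

theorem integral_circleExpSum_mul_conj_mul_fourier {f g : ℤ → ℂ} (hf : f.support.Finite)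
    (hg : g.support.Finite) (h : ℤ) :
    ∫ α, circleExpSum f α * (starRingEnd ℂ) (circleExpSum g α) * fourier h α =
      ∑ᶠ n : ℤ, f n * (starRingEnd ℂ) (g (n + h)) := by
  have hexp : ∀ α, circleExpSum f α * (starRingEnd ℂ) (circleExpSum g α) * fourier h α =
      ∑ n ∈ hf.toFinset, ∑ m ∈ hg.toFinset,
        f n * (starRingEnd ℂ) (g m) * fourier (n + -m + h) α := fun α => by
    rw [circleExpSum_eq_sum hf, circleExpSum_eq_sum hg, map_sum, Finset.sum_mul_sum,
      Finset.sum_mul]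
    refine Finset.sum_congr rfl fun n _ => ?_
    rw [Finset.sum_mul]
    refine Finset.sum_congr rfl fun m _ => ?_
    rw [fourier_add, fourier_add, fourier_neg, map_mul]
    ring
  have hint : ∀ n m : ℤ, Integrable
      (fun α : AddCircle (1 : ℝ) => f n * (starRingEnd ℂ) (g m) * fourier (n + -m + h) α) :=
    fun n m => (continuous_const.mul (map_continuous _)).integrable_of_hasCompactSupport
      (HasCompactSupport.of_compactSpace _)
  simp_rw [hexp]
  rw [integral_finsetSum _ fun n _ => integrable_finsetSum _ fun m _ => hint n m,
    finsum_eq_sum_of_support_subset (s := hf.toFinset) _ fun n hn => by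
      simpa using left_ne_zero_of_mul (Function.mem_support.1 hn)]
  refine Finset.sum_congr rfl fun n _ => ?_
  rw [integral_finsetSum _ fun m _ => hint n m]
  simp_rw [integral_const_mul, integral_fourier_eq_ite]
  have hiff : ∀ m : ℤ, n + -m + h = 0 ↔ n + h = m := fun m => by omega
  simp only [hiff, mul_ite, mul_one, mul_zero, Finset.sum_ite_eq, Set.Finite.mem_toFinset,
    Function.mem_support]
  split_ifs with h0
  · rfl
  · rw [not_not.1 h0]; simp

/-- **Circle method upper bound for averaged correlations.** -/
theorem circle_method_upper_bound :
    ∃ C : ℝ, ∀ H : ℝ, 1 ≤ H →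
    ∀ f g : ℤ → ℂ, (Function.support f).Finite → (Function.support g).Finite →
    ∀ 𝔐 : Set (AddCircle (1 : ℝ)), MeasurableSet 𝔐 →
    ∀ h₀ : ℤ,
      (∑ h ∈ Finset.Icc (h₀ - ⌊H⌋) (h₀ + ⌊H⌋),
          ‖(∑ᶠ n : ℤ, f n * (starRingEnd ℂ) (g (n + h))) -
              ∫ α in 𝔐, circleExpSum f α * (starRingEnd ℂ) (circleExpSum g α) * fourier h α‖ ^ 2)
        ≤ C * H *
          ∫ α in 𝔐ᶜ, ‖circleExpSum f α‖ * ‖circleExpSum g α‖ *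
            (∫ β in 𝔐ᶜ ∩ Metric.closedBall α (1 / (2 * H)),
              ‖circleExpSum f β‖ * ‖circleExpSum g β‖) := by
  classical
  refine ⟨12, fun H hH f g hf hg 𝔐 h𝔐 h₀ => ?_⟩
  have hH0 : 0 < H := by linarith
  set F : AddCircle (1 : ℝ) → ℂ := fun α => circleExpSum f α * (starRingEnd ℂ) (circleExpSum g α)
    with hF
  have hFc : Continuous F := (continuous_circleExpSum hf).mul
    (Complex.continuous_conj.comp (continuous_circleExpSum hg))
  have hFn : ∀ α, ‖circleExpSum f α‖ * ‖circleExpSum g α‖ = ‖F α‖ := fun α => by simp [hF]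
  have hFi : ∀ h : ℤ, Integrable (fun α => F α * fourier h α) := fun h =>
    (hFc.mul (map_continuous _)).integrable_of_hasCompactSupport
      (HasCompactSupport.of_compactSpace _)
  obtain ⟨M, hM⟩ := (isCompact_univ (X := AddCircle (1 : ℝ))).exists_bound_of_continuousOn
    hFc.continuousOn
  have hfn : ∀ (k : ℤ) (α : AddCircle (1 : ℝ)), ‖fourier k α‖ = 1 := fun k α => Circle.norm_coe _
  set φ : AddCircle (1 : ℝ) → ℂ := 𝔐ᶜ.indicator (fun α => F α * fourier h₀ α) with hφ
  have hφm : Measurable φ :=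
    (hFc.mul (map_continuous (fourier h₀))).measurable.indicator h𝔐.compl
  have hφn : ∀ α, ‖φ α‖ = 𝔐ᶜ.indicator (fun α => ‖F α‖) α := fun α => by
    rw [hφ, norm_indicator_eq_indicator_norm]
    simp only [norm_mul, hfn, mul_one]
  have hφM : ∀ α, ‖φ α‖ ≤ M := fun α => by
    rw [hφn]
    exact (Set.indicator_le_self' (fun _ _ => norm_nonneg _) α).trans (hM α trivial)
  have hterm : ∀ h : ℤ, (∑ᶠ n : ℤ, f n * (starRingEnd ℂ) (g (n + h))) -
      ∫ α in 𝔐, circleExpSum f α * (starRingEnd ℂ) (circleExpSum g α) * fourier h α =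
        fourierCoeff φ (h₀ - h) := fun h => by
    rw [← integral_circleExpSum_mul_conj_mul_fourier hf hg, ← integral_add_compl h𝔐 (hFi h),
      add_sub_cancel_left, fourierCoeff, AddCircle.integral_haarAddCircle, inv_one, one_smul,
      ← integral_indicator h𝔐.compl]
    refine integral_congr_ae (.of_forall fun α => ?_)
    simp only [hφ, Set.indicator_apply, smul_eq_mul]
    split_ifs
    · rw [show h = -(h₀ - h) + h₀ by ring, fourier_add]
      ring_nf
    · simp
  simp_rw [hFn]
  simp only [hterm]
  set s := (Finset.Icc (h₀ - ⌊H⌋) (h₀ + ⌊H⌋)).image (fun h => h₀ - h) with hs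
  have hsum : ∑ h ∈ Finset.Icc (h₀ - ⌊H⌋) (h₀ + ⌊H⌋), ‖fourierCoeff φ (h₀ - h)‖ ^ 2 =
      ∑ k ∈ s, ‖fourierCoeff φ k‖ ^ 2 := by
    rw [hs, Finset.sum_image fun a _ b _ h => by simpa using h]
  have hr : 2 * (1 / (6 * H)) ≤ 1 / (2 * H) := by
    rw [mul_one_div, div_le_div_iff₀ (by positivity) (by positivity)]; linarith
  have hr' : 2 * (1 / (6 * H)) ≤ 1 := hr.trans (by
    rw [div_le_one (by positivity)]; linarith)
  have hmain := sum_sq_fourierCoeff_le hφm hφM (r := 1 / (6 * H)) (by positivity) hr' s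
    (fun k hk => by
      obtain ⟨h, hh, rfl⟩ := Finset.mem_image.1 hk
      rw [Finset.mem_Icc] at hh
      have h1 : |h₀ - h| ≤ ⌊H⌋ := abs_le.2 ⟨by omega, by omega⟩
      have h2 : |((h₀ - h : ℤ) : ℝ)| ≤ H := by
        rw [← Int.cast_abs]
        exact (Int.cast_le.2 h1).trans (Int.floor_le H)
      calc _ ≤ H * (1 / (6 * H)) := by gcongr
        _ = 1 / 6 := by field_simp)
  rw [hsum]
  refine hmain.trans ?_
  have hconst : 2 / (1 / (6 * H)) = 12 * H := by field_simp; norm_num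
  rw [hconst, ← integral_indicator h𝔐.compl]
  refine mul_le_mul_of_nonneg_left ?_ (by positivity)
  have hin : ∀ (ρ : ℝ) (α : AddCircle (1 : ℝ)),
      ∫ β in Metric.closedBall α ρ, ‖φ β‖ = ∫ β in 𝔐ᶜ ∩ Metric.closedBall α ρ, ‖F β‖ :=
    fun ρ α => by
      simp_rw [hφn]
      rw [setIntegral_indicator h𝔐.compl, Set.inter_comm]
  have hpt : ∀ α, 𝔐ᶜ.indicator (fun α => ‖F α‖ *
      ∫ β in 𝔐ᶜ ∩ Metric.closedBall α (1 / (2 * H)), ‖F β‖) α =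
      ‖φ α‖ * ∫ β in Metric.closedBall α (1 / (2 * H)), ‖φ β‖ := fun α => by
    rw [hin, hφn]
    simp only [Set.indicator_apply]
    split_ifs <;> simp
  have hφi : Integrable (fun α => ‖φ α‖) :=
    (Integrable.of_bound hφm.aestronglyMeasurable M (.of_forall hφM)).norm
  have hUm : Measurable fun t : AddCircle (1 : ℝ) =>
      ∫ α in Metric.closedBall t (1 / (2 * H)), ‖φ α‖ :=
    measurable_setIntegral_closedBall volume hφm.norm _
  simp_rw [hpt]
  refine integral_mono_of_nonneg (.of_forall fun α => mul_nonneg (norm_nonneg _)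
    (integral_nonneg fun _ => norm_nonneg _)) ?_ (.of_forall fun α => ?_)
  · refine Integrable.of_bound (C := M * ∫ α, ‖φ α‖) (hφm.norm.mul hUm).aestronglyMeasurable
      (.of_forall fun α => ?_)
    rw [norm_mul, norm_norm, Real.norm_of_nonneg (integral_nonneg fun _ => norm_nonneg _)]
    exact mul_le_mul (hφM α) (setIntegral_le_integral hφi (.of_forall fun _ => norm_nonneg _))
      (integral_nonneg fun _ => norm_nonneg _) ((norm_nonneg _).trans (hφM α))
  · refine mul_le_mul_of_nonneg_left ?_ (norm_nonneg _)
    exact setIntegral_mono_set hφi.integrableOn (.of_forall fun _ => norm_nonneg _)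
      (Metric.closedBall_subset_closedBall hr).eventuallyLE
end

section
/- Stationary phase bound for short L² averages of exponential sums (generic β): There exist absolute constants c ∈ (0,1) and C > 0 such that the following holds. Let 1 ≤ H ≤ X, let f : ℕ → ℂ be supported on the integers in (X, 2X], and let β, η be real numbers with β ≠ 0, 0 < η ≤ c and |β| ≤ c·η. Set I := { t ∈ ℝ : η|β|X ≤ |t| ≤ |β|X/η }. Then ∫_{β−1/H}^{β+1/H} |S_f(θ)|² dθ ≤ C [ (1/(|β|²H²)) ∫_I ( ∫_{t−|β|H}^{t+|β|H} |D[f](1/2 + it')| dt' )² dt + ((η + 1/(|β|H))²/H²) ∫_ℝ ( ∑_{x ≤ n ≤ x+H} |f(n)| )² dx ]. -/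
open scoped BigOperators
open Real MeasureTheory

/-- `e(x) = e^{2πix}`. -/
noncomputable def eR (x : ℝ) : ℂ := Complex.exp (2 * Real.pi * Complex.I * x)

/-- The exponential sum `S_f(θ) = ∑_n f(n) e(θn)` of a (finitely supported)
function `f : ℕ → ℂ`. -/
noncomputable def expSumR (f : ℕ → ℂ) (θ : ℝ) : ℂ := ∑ᶠ n : ℕ, f n * eR (θ * n)

/-- The Dirichlet polynomial `D[f](s) = ∑_n f(n) n^{-s}`. -/
noncomputable def dirPoly (f : ℕ → ℂ) (s : ℂ) : ℂ := ∑ᶠ n : ℕ, f n / (n : ℂ) ^ s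

open FourierTransform

lemma integral_norm_sq_fourier {A : ℝ → ℂ} (h1 : Integrable A) (h2 : MemLp A 2) :
    Integrable (fun u => ‖𝓕 A u‖ ^ 2) ∧ ∫ u, ‖𝓕 A u‖ ^ 2 = ∫ x, ‖A x‖ ^ 2 := by
  set G : Lp ℂ 2 (volume : Measure ℝ) := 𝓕 (h2.toLp A) with hG
  have hcont : Continuous (𝓕 A) :=
    VectorFourier.fourierIntegral_continuous Real.continuous_fourierChar (by fun_prop) h1
  have hae : ∀ᵐ u, G u = 𝓕 A u := by
    refine ae_eq_of_integral_contDiff_smul_eq ?_ hcont.locallyIntegrable ?_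
    · exact (Lp.memLp G).locallyIntegrable (by norm_num)
    intro g hg hgc
    have hgc' : HasCompactSupport (fun x => (g x : ℂ)) := hgc.comp_left (g := fun x : ℝ => (x:ℂ)) (by simp)
    set φ : SchwartzMap ℝ ℂ := hgc'.toSchwartzMap (Complex.ofRealCLM.contDiff.comp hg) with hφ
    have key := congrArg (fun T => T φ) (Lp.fourier_toTemperedDistribution_eq (h2.toLp A))
    simp only [TemperedDistribution.fourier_apply, Lp.toTemperedDistribution_apply] at key
    have e1 : ∫ x, (𝓕 φ) x • (h2.toLp A) x = ∫ x, (𝓕 φ) x • A x := by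
      refine integral_congr_ae ?_
      filter_upwards [h2.coeFn_toLp] with x hx
      rw [hx]
    have e2 : ∫ x, g x • G x = ∫ x, φ x • G x := by
      rfl
    rw [e2, ← key, e1]
    have e3 := VectorFourier.integral_fourierIntegral_smul_eq_flip (μ := volume) (ν := volume)
      (L := innerₗ ℝ) (f := φ) (g := A) Real.continuous_fourierChar (by fun_prop) φ.integrable h1
    simp only [flip_innerₗ] at e3
    rw [SchwartzMap.fourier_coe]
    exact e3
  have hm : MemLp (𝓕 A) 2 := (memLp_congr_ae hae).1 (Lp.memLp G)
  refine ⟨hm.integrable_norm_pow (by norm_num), ?_⟩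
  have hn : ‖G‖ = ‖h2.toLp A‖ := Lp.norm_fourier_eq _
  have sq : ∀ F : Lp ℂ 2 (volume : Measure ℝ), ‖F‖ ^ 2 = ∫ x, ‖F x‖ ^ 2 := by
    intro F
    have := @inner_self_eq_norm_sq_to_K ℂ _ _ _ _ F
    rw [L2.inner_def] at this
    have h3 : ((‖F‖ ^ 2 : ℝ) : ℂ) = ((∫ x, ‖F x‖ ^ 2 : ℝ) : ℂ) := by
      rw [← integral_complex_ofReal]
      push_cast
      rw [← Complex.coe_algebraMap, ← this]
      congr 1
      ext x
      simp [inner_self_eq_norm_sq_to_K]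
    exact_mod_cast h3
  calc ∫ u, ‖𝓕 A u‖ ^ 2 = ∫ u, ‖G u‖ ^ 2 := integral_congr_ae (hae.mono fun x hx => by simp only [hx])
    _ = ∫ x, ‖(h2.toLp A) x‖ ^ 2 := by rw [← sq, hn, sq]
    _ = _ := integral_congr_ae (h2.coeFn_toLp.mono fun x hx => by simp only [hx])

lemma eR_eq_fourierChar (x : ℝ) : eR x = (𝐞 x : ℂ) := by
  rw [Real.fourierChar_apply, eR]
  congr 1
  push_cast
  ring

lemma eR_eq_exp (x : ℝ) : eR x = Complex.exp (((2 * π * x : ℝ) : ℂ) * Complex.I) := by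
  rw [eR]
  congr 1
  push_cast
  ring

lemma norm_eR (x : ℝ) : ‖eR x‖ = 1 := by
  rw [eR_eq_exp, Complex.norm_exp_ofReal_mul_I]

lemma eR_add (x y : ℝ) : eR (x + y) = eR x * eR y := by
  rw [eR, eR, eR, ← Complex.exp_add]
  congr 1
  push_cast
  ring

lemma continuous_eR : Continuous eR := by
  unfold eR
  fun_prop

lemma conj_eR (x : ℝ) : (starRingEnd ℂ) (eR x) = eR (-x) := by
  rw [eR_eq_exp, eR_eq_exp, ← Complex.exp_conj]
  congr 1
  rw [map_mul, Complex.conj_ofReal, Complex.conj_I]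
  push_cast
  ring

lemma fourier_eq_integral_eR (f : ℝ → ℂ) (w : ℝ) : 𝓕 f w = ∫ x, eR (-(x * w)) * f x := by
  rw [Real.fourier_real_eq]
  simp only [eR_eq_fourierChar, Circle.smul_def, smul_eq_mul]

lemma half_le_norm_integral_eR {L u : ℝ} (hL : 0 < L) (h : L * |u| ≤ 1 / 6) :
    L / 2 ≤ ‖∫ x in (0 : ℝ)..L, eR (x * u)‖ := by
  refine le_trans ?_ (Complex.re_le_norm _)
  have hc : Continuous fun x : ℝ => eR (x * u) := continuous_eR.comp (by fun_prop)
  have h1 : (∫ x in (0 : ℝ)..L, eR (x * u)).re = ∫ x in (0 : ℝ)..L, (eR (x * u)).re :=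
    (Complex.reCLM.intervalIntegral_comp_comm (hc.intervalIntegrable 0 L)).symm
  rw [h1]
  have h2 : ∫ _ in (0 : ℝ)..L, (1 / 2 : ℝ) = L / 2 := by
    simp; ring
  rw [← h2]
  refine intervalIntegral.integral_mono_on hL.le (by simp)
    ((Complex.continuous_re.comp hc).intervalIntegrable 0 L) fun x hx => ?_
  have h3 : (eR (x * u)).re = Real.cos (2 * π * (x * u)) := by
    rw [eR_eq_exp, Complex.exp_ofReal_mul_I_re]
  rw [h3, ← Real.cos_abs, ← Real.cos_pi_div_three]
  have h4 : |x * u| ≤ 1 / 6 := by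
    rw [abs_mul, abs_of_nonneg hx.1]
    exact (mul_le_mul_of_nonneg_right hx.2 (abs_nonneg u)).trans h
  have h5 : |2 * π * (x * u)| = 2 * π * |x * u| := by
    rw [abs_mul, abs_of_pos Real.two_pi_pos]
  have := Real.pi_pos
  refine Real.cos_le_cos_of_nonneg_of_le_pi (abs_nonneg _) (by linarith) ?_
  rw [h5]
  nlinarith

section Gallagher

variable {Ω : Type*} [MeasurableSpace Ω] {μ : Measure Ω} [SFinite μ]

lemma integrable_window {a : Ω → ℂ} (ha : Integrable a μ) {p : Ω → ℝ} (hp : Measurable p)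
    {L : ℝ} (hL : 0 < L) :
    Integrable ({q : ℝ × Ω | q.1 ≤ p q.2 ∧ p q.2 ≤ q.1 + L}.indicator fun q => a q.2)
      (volume.prod μ) := by
  have hS : MeasurableSet {q : ℝ × Ω | q.1 ≤ p q.2 ∧ p q.2 ≤ q.1 + L} :=
    (measurableSet_le measurable_fst (hp.comp measurable_snd)).inter
      (measurableSet_le (hp.comp measurable_snd) (measurable_fst.add_const L))
  have hsec : ∀ ω, (fun x => {q : ℝ × Ω | q.1 ≤ p q.2 ∧ p q.2 ≤ q.1 + L}.indicator
      (fun q => a q.2) (x, ω)) = (Set.Icc (p ω - L) (p ω)).indicator fun _ => a ω := by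
    intro ω
    ext x
    simp only [Set.indicator, Set.mem_ofPred_eq, Set.mem_Icc]
    congr 1
    simp only [eq_iff_iff]
    constructor <;> rintro ⟨h1, h2⟩ <;> constructor <;> linarith
  refine (integrable_prod_iff' (ha.1.comp_snd.indicator hS)).2 ⟨?_, ?_⟩
  · refine Filter.Eventually.of_forall fun ω => ?_
    rw [hsec]
    exact (integrable_indicator_iff measurableSet_Icc).2 (integrableOn_const (by simp))
  · have : (fun ω => ∫ x, ‖{q : ℝ × Ω | q.1 ≤ p q.2 ∧ p q.2 ≤ q.1 + L}.indicator
        (fun q => a q.2) (x, ω)‖) = fun ω => L * ‖a ω‖ := by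
      ext ω
      have h2 := hsec ω
      calc _ = ∫ x, ‖(Set.Icc (p ω - L) (p ω)).indicator (fun _ => a ω) x‖ := by
            refine integral_congr_ae (Filter.Eventually.of_forall fun x => ?_)
            simp only [← h2]
        _ = ∫ x, (Set.Icc (p ω - L) (p ω)).indicator (fun _ => ‖a ω‖) x := by
            simp only [norm_indicator_eq_indicator_norm]
        _ = _ := by
            rw [integral_indicator measurableSet_Icc]
            simp [hL.le]
    rw [this]
    exact ha.norm.const_mul L

lemma integrable_window_sq {a : Ω → ℂ} (ha : Integrable a μ) {p : Ω → ℝ} (hp : Measurable p)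
    {L : ℝ} (hL : 0 < L) :
    Integrable (fun x => (∫ ω in {ω | x ≤ p ω ∧ p ω ≤ x + L}, ‖a ω‖ ∂μ) ^ 2) := by
  have hS : ∀ x, MeasurableSet {ω | x ≤ p ω ∧ p ω ≤ x + L} := fun x =>
    (measurableSet_le measurable_const hp).inter (measurableSet_le hp measurable_const)
  have h1 := (integrable_window ha hp hL).norm.integral_prod_left
  have h2 : (fun x => ∫ ω in {ω | x ≤ p ω ∧ p ω ≤ x + L}, ‖a ω‖ ∂μ) = fun x => ∫ ω,
      ‖{q : ℝ × Ω | q.1 ≤ p q.2 ∧ p q.2 ≤ q.1 + L}.indicator (fun q => a q.2) (x, ω)‖ ∂μ := by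
    ext x
    rw [← integral_indicator (hS x)]
    simp only [norm_indicator_eq_indicator_norm]
    rfl
  rw [← h2] at h1
  simp only [pow_two]
  refine h1.bdd_mul (c := ∫ ω, ‖a ω‖ ∂μ) h1.1 (Filter.Eventually.of_forall fun x => ?_)
  rw [Real.norm_of_nonneg (integral_nonneg fun _ => norm_nonneg _)]
  exact setIntegral_le_integral ha.norm (Filter.Eventually.of_forall fun _ => norm_nonneg _)

/-- Gallagher's inequality for the exponential integral of an integrable function. -/
lemma gallagher {a : Ω → ℂ} (ha : Integrable a μ) {p : Ω → ℝ} (hp : Measurable p)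
    {L U : ℝ} (hL : 0 < L) (hU : 0 ≤ U) (hLU : L * U ≤ 1 / 6) :
    ∫ u in (-U)..U, ‖∫ ω, a ω * eR (u * p ω) ∂μ‖ ^ 2 ≤
      4 / L ^ 2 * ∫ x, (∫ ω in {ω | x ≤ p ω ∧ p ω ≤ x + L}, ‖a ω‖ ∂μ) ^ 2 := by
  have hS : ∀ x, MeasurableSet {ω | x ≤ p ω ∧ p ω ≤ x + L} := fun x =>
    (measurableSet_le measurable_const hp).inter (measurableSet_le hp measurable_const)
  set A : ℝ → ℂ := fun x => ∫ ω in {ω | x ≤ p ω ∧ p ω ≤ x + L}, a ω ∂μ with hA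
  have hW := integrable_window ha hp hL
  have hA' : A = fun x => ∫ ω,
      {q : ℝ × Ω | q.1 ≤ p q.2 ∧ p q.2 ≤ q.1 + L}.indicator (fun q => a q.2) (x, ω) ∂μ := by
    ext x
    rw [hA]
    simp only
    rw [← integral_indicator (hS x)]
    rfl
  have hA1 : Integrable A := by
    rw [hA']
    exact hW.integral_prod_left
  have hsq := integrable_window_sq ha hp hL
  have hle : ∀ x, ‖A x‖ ^ 2 ≤ (∫ ω in {ω | x ≤ p ω ∧ p ω ≤ x + L}, ‖a ω‖ ∂μ) ^ 2 := fun x =>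
    pow_le_pow_left₀ (norm_nonneg _) (norm_integral_le_integral_norm _) 2
  have hA2 : MemLp A 2 := by
    refine (memLp_two_iff_integrable_sq_norm hA1.1).2 (hsq.mono' (hA1.1.norm.pow 2) ?_)
    refine Filter.Eventually.of_forall fun x => ?_
    rw [Real.norm_of_nonneg (by positivity)]
    exact hle x
  obtain ⟨hF1, hF2⟩ := integral_norm_sq_fourier hA1 hA2
  have hF : ∀ w, 𝓕 A w = (∫ ω, a ω * eR (-w * p ω) ∂μ) * ∫ x in (0 : ℝ)..L, eR (x * w) := by
    intro w
    have hWw : Integrable (Function.uncurry fun (x : ℝ) (ω : Ω) => eR (-(x * w)) *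
        {q : ℝ × Ω | q.1 ≤ p q.2 ∧ p q.2 ≤ q.1 + L}.indicator (fun q => a q.2) (x, ω))
        (volume.prod μ) := by
      refine hW.bdd_mul (c := 1) ?_ (Filter.Eventually.of_forall fun q => (norm_eR _).le)
      exact ((continuous_eR.comp (f := fun x : ℝ => -(x * w))
        (by fun_prop)).measurable.comp measurable_fst).aestronglyMeasurable
    rw [fourier_eq_integral_eR, hA']
    simp only [← integral_const_mul]
    rw [integral_integral_swap hWw, ← integral_mul_const]
    refine integral_congr_ae (Filter.Eventually.of_forall fun ω => ?_)
    simp only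
    have e1 : ∀ x, eR (-(x * w)) *
        {q : ℝ × Ω | q.1 ≤ p q.2 ∧ p q.2 ≤ q.1 + L}.indicator (fun q => a q.2) (x, ω) =
        (Set.Icc (p ω - L) (p ω)).indicator (fun x => a ω * eR (-(x * w))) x := by
      intro x
      have : (x ≤ p ω ∧ p ω ≤ x + L) ↔ (p ω - L ≤ x ∧ x ≤ p ω) := by
        constructor <;> rintro ⟨h1, h2⟩ <;> constructor <;> linarith
      by_cases h : x ≤ p ω ∧ p ω ≤ x + L
      · rw [Set.indicator_of_mem (by exact h), Set.indicator_of_mem (by exact this.1 h), mul_comm]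
      · rw [Set.indicator_of_notMem (by exact h),
          Set.indicator_of_notMem (by exact fun h' => h (this.2 h')), mul_zero]
    simp only [e1]
    rw [integral_indicator measurableSet_Icc, integral_Icc_eq_integral_Ioc,
      ← intervalIntegral.integral_of_le (by linarith), intervalIntegral.integral_const_mul,
      mul_assoc]
    congr 1
    rw [← intervalIntegral.integral_const_mul]
    have := intervalIntegral.integral_comp_sub_left (a := 0) (b := L)
      (fun x => eR (-(x * w))) (p ω)
    rw [sub_zero] at this
    rw [← this]
    congr 1
    ext x
    rw [← eR_add]
    congr 1
    ring
  have hpt : ∀ u ∈ Set.Icc (-U) U, ‖∫ ω, a ω * eR (u * p ω) ∂μ‖ ^ 2 ≤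
      4 / L ^ 2 * ‖𝓕 A (-u)‖ ^ 2 := by
    intro u hu
    have hk := half_le_norm_integral_eR (u := -u) hL (by
      rw [abs_neg]
      exact (mul_le_mul_of_nonneg_left (abs_le.2 hu) hL.le).trans hLU)
    rw [hF, neg_neg, norm_mul, mul_pow]
    have : (L / 2) ^ 2 ≤ ‖∫ x in (0 : ℝ)..L, eR (x * -u)‖ ^ 2 :=
      pow_le_pow_left₀ (by positivity) hk 2
    calc ‖∫ ω, a ω * eR (u * p ω) ∂μ‖ ^ 2
        = 4 / L ^ 2 * (‖∫ ω, a ω * eR (u * p ω) ∂μ‖ ^ 2 * (L / 2) ^ 2) := by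
          field_simp
          norm_num
      _ ≤ _ := by gcongr
  have hneg : Integrable fun u => ‖𝓕 A (-u)‖ ^ 2 := hF1.comp_neg
  calc ∫ u in (-U)..U, ‖∫ ω, a ω * eR (u * p ω) ∂μ‖ ^ 2
      ≤ ∫ u in (-U)..U, 4 / L ^ 2 * ‖𝓕 A (-u)‖ ^ 2 := by
        rw [intervalIntegral.integral_of_le (by linarith),
          intervalIntegral.integral_of_le (by linarith)]
        refine integral_mono_of_nonneg (Filter.Eventually.of_forall fun _ => by positivity)
          (hneg.const_mul _).integrableOn ?_
        exact (ae_restrict_iff' measurableSet_Ioc).2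
          (Filter.Eventually.of_forall fun u hu => hpt u (Set.Ioc_subset_Icc_self hu))
    _ ≤ 4 / L ^ 2 * ∫ u, ‖𝓕 A (-u)‖ ^ 2 := by
        rw [intervalIntegral.integral_const_mul, intervalIntegral.integral_of_le (by linarith)]
        exact mul_le_mul_of_nonneg_left (setIntegral_le_integral hneg
          (Filter.Eventually.of_forall fun _ => by positivity)) (by positivity)
    _ = 4 / L ^ 2 * ∫ x, ‖A x‖ ^ 2 := by
        rw [integral_neg_eq_self (fun u => ‖𝓕 A u‖ ^ 2), hF2]
    _ ≤ _ := by
        exact mul_le_mul_of_nonneg_left (integral_mono_of_nonneg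
          (Filter.Eventually.of_forall fun _ => by positivity) hsq
          (Filter.Eventually.of_forall hle)) (by positivity)

end Gallagher

section OscillatoryIntegral

lemma exists_amplitude : ∃ (a a₁ a₂ : ℝ → ℝ) (M : ℝ), 0 < M ∧ (∀ v, HasDerivAt a (a₁ v) v) ∧
    (∀ v, HasDerivAt a₁ (a₂ v) v) ∧ Continuous a₂ ∧ (∀ v, |a v| ≤ M) ∧ (∀ v, |a₁ v| ≤ M) ∧
    (∀ v, |a₂ v| ≤ M) ∧ (∀ v, 3 ≤ |v| → a v = 0 ∧ a₁ v = 0) ∧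
    ∀ v, |v| ≤ 2 → a v = Real.exp (v / 2) := by
  let b : ContDiffBump (0 : ℝ) := ⟨2, 5 / 2, by norm_num, by norm_num⟩
  set a : ℝ → ℝ := fun v => b v * Real.exp (v / 2) with ha
  have hsm : ContDiff ℝ 2 a := b.contDiff.mul (Real.contDiff_exp.comp (contDiff_id.div_const 2))
  have hc : HasCompactSupport a := b.hasCompactSupport.mul_right
  have hd1 : ContDiff ℝ 1 (deriv a) := ((contDiff_succ_iff_deriv (n := 1)).1 hsm).2.2
  have hd2 : Continuous (deriv (deriv a)) := hd1.continuous_deriv le_rfl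
  obtain ⟨M₀, hM₀⟩ := hc.exists_bound_of_continuous hsm.continuous
  obtain ⟨M₁, hM₁⟩ := hc.deriv.exists_bound_of_continuous hd1.continuous
  obtain ⟨M₂, hM₂⟩ := hc.deriv.deriv.exists_bound_of_continuous hd2
  refine ⟨a, deriv a, deriv (deriv a), max 1 (max M₀ (max M₁ M₂)), by positivity,
    fun v => ((hsm.differentiable (by norm_num)) v).hasDerivAt,
    fun v => ((hd1.differentiable (by norm_num)) v).hasDerivAt, hd2,
    fun v => (hM₀ v).trans (by simp), fun v => (hM₁ v).trans (by simp),
    fun v => (hM₂ v).trans (by simp), fun v hv => ?_, fun v hv => ?_⟩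
  · have h0 : a =ᶠ[nhds v] fun _ => 0 := by
      have : {w : ℝ | 5 / 2 < |w|} ∈ nhds v :=
        (isOpen_lt continuous_const continuous_abs).mem_nhds (by
          change 5 / 2 < |v|
          linarith)
      filter_upwards [this] with w hw
      have : b w = 0 := b.zero_of_le_dist (by
        rw [Real.dist_eq, sub_zero]
        exact le_of_lt hw)
      simp [ha, this]
    refine ⟨h0.eq_of_nhds, ?_⟩
    rw [h0.deriv_eq]
    simp
  · have : b v = 1 := b.one_of_mem_closedBall (by
      rw [Metric.mem_closedBall, Real.dist_eq, sub_zero]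
      exact hv)
    simp [ha, this]

variable {a a₁ a₂ : ℝ → ℝ} {M Y : ℝ}

lemma hasDerivAt_eR_phase (Y ξ v : ℝ) :
    HasDerivAt (fun v : ℝ => eR (Y * Real.exp v - v * ξ))
      (Complex.I * ((2 * π * (Y * Real.exp v - ξ) : ℝ) : ℂ) * eR (Y * Real.exp v - v * ξ)) v := by
  have h1 : HasDerivAt (fun v : ℝ => 2 * π * (Y * Real.exp v - v * ξ))
      (2 * π * (Y * Real.exp v - ξ)) v := by
    have := (((Real.hasDerivAt_exp v).const_mul Y).sub
      ((hasDerivAt_id v).mul_const ξ)).const_mul (2 * π)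
    simpa using this
  have h2 := (h1.ofReal_comp.mul_const Complex.I).cexp
  simp only [eR_eq_exp]
  convert h2 using 1
  ring

lemma norm_oscillatory_le (ha : ∀ v, HasDerivAt a (a₁ v) v) (ha₁ : Continuous a₁)
    (hM : ∀ v, |a v| ≤ M) (hM₁ : ∀ v, |a₁ v| ≤ M) (h0 : ∀ v, 3 ≤ |v| → a v = 0)
    (hY : 0 < Y) (ξ : ℝ) :
    ‖∫ v in (-3 : ℝ)..3, (a v : ℂ) * eR (Y * Real.exp v - v * ξ)‖ ≤
      (6 + (1 + Real.exp 3) * π) * M / √Y := by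
  have hM0 : 0 ≤ M := (abs_nonneg _).trans (hM 0)
  have hY' : 0 < √Y := Real.sqrt_pos.2 hY
  have hpi := Real.pi_pos
  have hca : Continuous a := continuous_iff_continuousAt.2 fun v => (ha v).continuousAt
  set P : ℝ → ℂ := fun v => eR (Y * Real.exp v - v * ξ) with hP
  set s : ℝ → ℝ := fun v => 2 * π * (Y * Real.exp v - ξ) with hs
  set E : ℝ → ℝ := fun v => 2 * π * (Y * Real.exp v) with hE
  set D : ℝ → ℝ := fun v => s v ^ 2 + Y with hD
  have hDpos : ∀ v, 0 < D v := fun v => by positivity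
  have hEpos : ∀ v, 0 < E v := fun v => by positivity
  have hsd : ∀ v, HasDerivAt s (E v) v := fun v =>
    (((Real.hasDerivAt_exp v).const_mul Y).sub_const ξ).const_mul (2 * π)
  have hDd : ∀ v, HasDerivAt D (2 * s v * E v) v := fun v => by
    refine (((hsd v).pow 2).add_const Y).congr_deriv ?_
    norm_num
  have hφd : ∀ v, HasDerivAt (fun v => s v / D v) (E v * (Y - s v ^ 2) / D v ^ 2) v := fun v => by
    refine ((hsd v).div (hDd v) (hDpos v).ne').congr_deriv ?_
    simp only [hD]
    ring
  have hcs : Continuous s := by fun_prop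
  have hcE : Continuous E := by fun_prop
  have hcD : Continuous D := by fun_prop
  have hcP : Continuous P := continuous_eR.comp (by fun_prop)
  set F' : ℝ → ℂ := fun v =>
    ((a₁ v * (s v / D v) + a v * (E v * (Y - s v ^ 2) / D v ^ 2) : ℝ) : ℂ) * P v +
      ((a v * (s v / D v) : ℝ) : ℂ) * (Complex.I * (s v : ℂ) * P v) with hF'
  have hF : ∀ v, HasDerivAt (fun v => ((a v * (s v / D v) : ℝ) : ℂ) * P v) (F' v) v := fun v =>
    ((ha v).mul (hφd v)).ofReal_comp.mul (hasDerivAt_eR_phase Y ξ v)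
  have hcF' : Continuous F' := by
    have h1 : Continuous fun v => s v / D v := hcs.div hcD fun v => (hDpos v).ne'
    have h2 : Continuous fun v => E v * (Y - s v ^ 2) / D v ^ 2 :=
      (hcE.mul (by fun_prop)).div (hcD.pow 2) fun v => (pow_pos (hDpos v) 2).ne'
    fun_prop
  have hF'0 : ∫ v in (-3 : ℝ)..3, F' v = 0 := by
    rw [intervalIntegral.integral_eq_sub_of_hasDerivAt (fun v _ => hF v)
      (hcF'.intervalIntegrable _ _), h0 3 (by norm_num), h0 (-3) (by norm_num)]
    simp
  have hJ : ∫ v in (-3 : ℝ)..3, (a v : ℂ) * P v =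
      ∫ v in (-3 : ℝ)..3, ((a v : ℂ) * P v + Complex.I * F' v) := by
    rw [intervalIntegral.integral_add ((by fun_prop : Continuous _).intervalIntegrable _ _)
      ((by fun_prop : Continuous _).intervalIntegrable _ _),
      intervalIntegral.integral_const_mul, hF'0]
    simp
  have hgd : ∀ v, HasDerivAt (fun v => M / √Y * v + (1 + Real.exp 3) * M / √Y *
      Real.arctan (s v / √Y)) (M / √Y + (1 + Real.exp 3) * M * (E v / D v)) v := fun v => by
    have h1 := ((hsd v).div_const (√Y)).arctan.const_mul ((1 + Real.exp 3) * M / √Y)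
    have h2 := ((hasDerivAt_id v).const_mul (M / √Y)).add h1
    refine h2.congr_deriv ?_
    have : (√Y) ^ 2 = Y := Real.sq_sqrt hY.le
    have h3 : D v = Y * (1 + (s v / √Y) ^ 2) := by
      rw [div_pow, this]
      simp only [hD]
      field_simp
      ring
    have h4 : 0 < 1 + (s v / √Y) ^ 2 := by positivity
    have h5 : ∀ r k e : ℝ, 0 < r → 0 < k → M / r * 1 + (1 + Real.exp 3) * M / r *
        (1 / k * (e / r)) = M / r + (1 + Real.exp 3) * M * (e / (r ^ 2 * k)) := by
      intro r k e hr hk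
      field_simp
    rw [h5 _ _ _ hY' h4, this, ← h3]
  have hg : ∫ v in (-3 : ℝ)..3, (M / √Y + (1 + Real.exp 3) * M * (E v / D v)) ≤
      (6 + (1 + Real.exp 3) * π) * M / √Y := by
    rw [intervalIntegral.integral_eq_sub_of_hasDerivAt (fun v _ => hgd v)
      ((continuous_const.add (continuous_const.mul
        (hcE.div hcD fun v => (hDpos v).ne'))).intervalIntegrable _ _)]
    have h1 := Real.arctan_lt_pi_div_two (s 3 / √Y)
    have h2 := Real.neg_pi_div_two_lt_arctan (s (-3) / √Y)
    have h3 : 0 ≤ (1 + Real.exp 3) * M / √Y := by positivity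
    have h4 : (6 + (1 + Real.exp 3) * π) * M / √Y =
      M / √Y * 6 + (1 + Real.exp 3) * M / √Y * π := by ring
    rw [h4]
    nlinarith
  rw [hJ]
  refine (intervalIntegral.norm_integral_le_of_norm_le
    (g := fun v => M / √Y + (1 + Real.exp 3) * M * (E v / D v)) (by norm_num)
    (Filter.Eventually.of_forall fun v hv => ?_)
    ((continuous_const.add (continuous_const.mul
        (hcE.div hcD fun v => (hDpos v).ne'))).intervalIntegrable _ _)).trans hg
  have e1 : (a v : ℂ) * P v + Complex.I * F' v = (((a v * (Y / D v) : ℝ) : ℂ) + Complex.I *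
      ((a₁ v * (s v / D v) + a v * (E v * (Y - s v ^ 2) / D v ^ 2) : ℝ) : ℂ)) * P v := by
    have h1 : (a v : ℂ) = ((a v * (Y / D v) + a v * (s v / D v) * s v : ℝ) : ℂ) := by
      congr 1
      have := (hDpos v).ne'
      field_simp
      simp only [hD]
      ring
    simp only [hF']
    nth_rewrite 1 [h1]
    push_cast
    linear_combination ((a v : ℂ) * (s v / D v) * s v * P v) * Complex.I_sq
  have hφ : |s v / D v| ≤ 1 / √Y := by
    rw [abs_div, abs_of_pos (hDpos v), div_le_div_iff₀ (hDpos v) hY']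
    have h1 : (√Y) ^ 2 = Y := Real.sq_sqrt hY.le
    have h2 : s v ^ 2 = |s v| ^ 2 := (sq_abs _).symm
    simp only [hD]
    rw [h2]
    nlinarith [sq_nonneg (|s v| - √Y), abs_nonneg (s v)]
  have hφ' : |E v * (Y - s v ^ 2) / D v ^ 2| ≤ E v / D v := by
    rw [abs_div, abs_mul, abs_of_pos (hEpos v), abs_of_pos (pow_pos (hDpos v) 2),
      div_le_div_iff₀ (pow_pos (hDpos v) 2) (hDpos v)]
    have h1 : |Y - s v ^ 2| ≤ D v := by
      rw [abs_le]
      simp only [hD]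
      constructor <;> nlinarith [sq_nonneg (s v)]
    calc E v * |Y - s v ^ 2| * D v ≤ E v * D v * D v := by
          have := hEpos v
          have := hDpos v
          gcongr
      _ = _ := by ring
  have hYE : Y / D v ≤ Real.exp 3 * (E v / D v) := by
    rw [← mul_div_assoc]
    refine div_le_div_of_nonneg_right ?_ (hDpos v).le
    have h1 : 1 ≤ Real.exp 3 * Real.exp v := by
      rw [← Real.exp_add]
      exact Real.one_le_exp (by linarith [hv.1])
    have h2 : 1 ≤ 2 * π := by linarith [Real.pi_gt_three]
    simp only [hE]
    calc Y = 1 * (1 * Y) := by ring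
      _ ≤ (2 * π) * ((Real.exp 3 * Real.exp v) * Y) := by gcongr
      _ = _ := by ring
  have hPn : ‖P v‖ = 1 := norm_eR _
  rw [e1, norm_mul, hPn, mul_one]
  refine (norm_add_le _ _).trans ?_
  rw [norm_mul, Complex.norm_I, one_mul, Complex.norm_real, Complex.norm_real,
    Real.norm_eq_abs, Real.norm_eq_abs]
  have b1 : |a v * (Y / D v)| ≤ M * (Real.exp 3 * (E v / D v)) := by
    rw [abs_mul, abs_of_pos (div_pos hY (hDpos v))]
    exact mul_le_mul (hM v) hYE (div_pos hY (hDpos v)).le hM0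
  have b2 : |a₁ v * (s v / D v)| ≤ M * (1 / √Y) := by
    rw [abs_mul]
    exact mul_le_mul (hM₁ v) hφ (abs_nonneg _) hM0
  have b3 : |a v * (E v * (Y - s v ^ 2) / D v ^ 2)| ≤ M * (E v / D v) := by
    rw [abs_mul]
    exact mul_le_mul (hM v) hφ' (abs_nonneg _) hM0
  have b4 := abs_add_le (a₁ v * (s v / D v)) (a v * (E v * (Y - s v ^ 2) / D v ^ 2))
  have b5 : M / √Y = M * (1 / √Y) := by ring
  rw [b5]
  linarith

lemma phase_deriv_bounds (hY : 0 < Y) {ξ v : ℝ}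
    (hξ : ξ ∉ Set.Icc (Real.exp (-4) * Y) (Real.exp 4 * Y)) (hv : v ∈ Set.Icc (-3 : ℝ) 3) :
    Real.exp (-3) * (Y + |ξ|) ≤ |2 * π * (Y * Real.exp v - ξ)| ∧
      2 * π * (Y * Real.exp v) ≤ 2 * |2 * π * (Y * Real.exp v - ξ)| := by
  have hpi := Real.pi_gt_three
  have he1 : (2 : ℝ) ≤ Real.exp 1 := by
    have := Real.add_one_le_exp (1 : ℝ)
    linarith
  have hv1 : Real.exp (-3) ≤ Real.exp v := Real.exp_le_exp.2 hv.1
  have hv2 : Real.exp v ≤ Real.exp 3 := Real.exp_le_exp.2 hv.2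
  have h4 : Real.exp 4 = Real.exp 1 * Real.exp 3 := by rw [← Real.exp_add]; norm_num
  have h4' : Real.exp (-3) = Real.exp 1 * Real.exp (-4) := by rw [← Real.exp_add]; norm_num
  have hp3 := Real.exp_pos 3
  have hm3 := Real.exp_pos (-3)
  have hm4 := Real.exp_pos (-4)
  have hm3' : Real.exp (-3) ≤ 1 := Real.exp_le_one_iff.2 (by norm_num)
  rw [abs_mul, abs_of_pos (by positivity : 0 < 2 * π)]
  have hv1Y : Real.exp (-3) * Y ≤ Y * Real.exp v := by nlinarith
  have hv2Y : Y * Real.exp v ≤ Real.exp 3 * Y := by nlinarith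
  suffices h : Real.exp (-3) * (Y + |ξ|) ≤ 6 * |Y * Real.exp v - ξ| ∧
      Y * Real.exp v ≤ 2 * |Y * Real.exp v - ξ| by
    constructor
    · nlinarith [abs_nonneg (Y * Real.exp v - ξ)]
    · nlinarith [abs_nonneg (Y * Real.exp v - ξ)]
  rw [Set.mem_Icc, not_and_or, not_le, not_le] at hξ
  rcases hξ with hξ | hξ
  · have h5 : 2 * (Real.exp (-4) * Y) ≤ Real.exp (-3) * Y := by
      rw [h4', mul_assoc]
      exact mul_le_mul_of_nonneg_right he1 (by positivity)
    have h6 : 0 ≤ Y * Real.exp v - ξ := by nlinarith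
    rw [abs_of_nonneg h6]
    refine ⟨?_, by linarith⟩
    rcases abs_cases ξ with ⟨h7, h8⟩ | ⟨h7, h8⟩
    · rw [h7]
      nlinarith
    · rw [h7]
      nlinarith
  · have h5 : 2 * (Real.exp 3 * Y) ≤ Real.exp 4 * Y := by
      rw [h4, mul_assoc]
      exact mul_le_mul_of_nonneg_right he1 (by positivity)
    have h6 : Y * Real.exp v - ξ ≤ 0 := by nlinarith
    have h7 : 0 < ξ := by nlinarith
    rw [abs_of_nonpos h6, abs_of_pos h7]
    have h8 : Y ≤ Real.exp 3 * Y := by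
      nlinarith [Real.one_le_exp (by norm_num : (0 : ℝ) ≤ 3)]
    refine ⟨?_, by linarith⟩
    nlinarith

lemma norm_oscillatory_le_of_notMem (ha : ∀ v, HasDerivAt a (a₁ v) v)
    (ha₁ : ∀ v, HasDerivAt a₁ (a₂ v) v) (ha₂ : Continuous a₂)
    (hM : ∀ v, |a v| ≤ M) (hM₁ : ∀ v, |a₁ v| ≤ M) (hM₂ : ∀ v, |a₂ v| ≤ M)
    (h0 : ∀ v, 3 ≤ |v| → a v = 0 ∧ a₁ v = 0) (hY : 0 < Y) {ξ : ℝ}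
    (hξ : ξ ∉ Set.Icc (Real.exp (-4) * Y) (Real.exp 4 * Y)) :
    ‖∫ v in (-3 : ℝ)..3, (a v : ℂ) * eR (Y * Real.exp v - v * ξ)‖ ≤
      126 * M * Real.exp 6 / (Y + |ξ|) ^ 2 := by
  have hM0 : 0 ≤ M := (abs_nonneg _).trans (hM 0)
  have hca : Continuous a := continuous_iff_continuousAt.2 fun v => (ha v).continuousAt
  have hca₁ : Continuous a₁ := continuous_iff_continuousAt.2 fun v => (ha₁ v).continuousAt
  have hI : Set.uIcc (-3 : ℝ) 3 = Set.Icc (-3) 3 := Set.uIcc_of_le (by norm_num)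
  have hYξ : 0 < Y + |ξ| := by positivity
  set P : ℝ → ℂ := fun v => eR (Y * Real.exp v - v * ξ) with hP
  set s : ℝ → ℝ := fun v => 2 * π * (Y * Real.exp v - ξ) with hs
  set E : ℝ → ℝ := fun v => 2 * π * (Y * Real.exp v) with hE
  have hsd : ∀ v, HasDerivAt s (E v) v := fun v =>
    (((Real.hasDerivAt_exp v).const_mul Y).sub_const ξ).const_mul (2 * π)
  have hEd : ∀ v, HasDerivAt E (E v) v := fun v =>
    ((Real.hasDerivAt_exp v).const_mul Y).const_mul (2 * π)
  have hEpos : ∀ v, 0 < E v := fun v => by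
    have := Real.pi_pos
    positivity
  have hs1 : ∀ v ∈ Set.Icc (-3 : ℝ) 3, Real.exp (-3) * (Y + |ξ|) ≤ |s v| := fun v hv =>
    (phase_deriv_bounds hY hξ hv).1
  have hs2 : ∀ v ∈ Set.Icc (-3 : ℝ) 3, E v ≤ 2 * |s v| := fun v hv =>
    (phase_deriv_bounds hY hξ hv).2
  have hs0 : ∀ v ∈ Set.Icc (-3 : ℝ) 3, s v ≠ 0 := fun v hv =>
    abs_pos.1 (lt_of_lt_of_le (by positivity) (hs1 v hv))
  have hcs : Continuous s := by fun_prop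
  have hcE : Continuous E := by fun_prop
  have hcP : Continuous P := continuous_eR.comp (by fun_prop)
  -- successive amplitudes of the two integrations by parts
  set b : ℝ → ℝ := fun v => a₁ v - a v * (E v / s v) with hb
  set g : ℝ → ℝ := fun v => a₂ v - 3 * a₁ v * (E v / s v) - a v * (E v / s v) +
    3 * a v * (E v / s v) ^ 2 with hg
  have hqd : ∀ v ∈ Set.Icc (-3 : ℝ) 3, HasDerivAt (fun v => (s v)⁻¹) (-E v / s v ^ 2) v :=
    fun v hv => (hsd v).inv (hs0 v hv)
  have hrd : ∀ v ∈ Set.Icc (-3 : ℝ) 3, HasDerivAt (fun v => E v / s v)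
      (E v / s v - (E v / s v) ^ 2) v := fun v hv => by
    refine ((hEd v).div (hsd v) (hs0 v hv)).congr_deriv ?_
    have := hs0 v hv
    field_simp
  have hF1 : ∀ v ∈ Set.Icc (-3 : ℝ) 3, HasDerivAt (fun v => a v * (s v)⁻¹)
      (b v * (s v)⁻¹) v := fun v hv => by
    refine ((ha v).mul (hqd v hv)).congr_deriv ?_
    have := hs0 v hv
    simp only [hb]
    field_simp
    ring
  have hG1 : ∀ v ∈ Set.Icc (-3 : ℝ) 3, HasDerivAt (fun v => b v * (s v)⁻¹ ^ 2)
      (g v * (s v)⁻¹ ^ 2) v := fun v hv => by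
    refine (((ha₁ v).sub ((ha v).mul (hrd v hv))).mul ((hqd v hv).pow 2)).congr_deriv ?_
    have := hs0 v hv
    simp only [hg, Pi.sub_apply, Pi.mul_apply, Pi.pow_apply]
    push_cast
    field_simp
    ring
  have hH : ∀ v ∈ Set.Icc (-3 : ℝ) 3, HasDerivAt (fun v => Complex.I *
      (((a v * (s v)⁻¹ : ℝ) : ℂ) * P v) - ((b v * (s v)⁻¹ ^ 2 : ℝ) : ℂ) * P v)
      (-((a v : ℂ) * P v) - ((g v * (s v)⁻¹ ^ 2 : ℝ) : ℂ) * P v) v := fun v hv => by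
    have h1 := (hF1 v hv).ofReal_comp.mul (hasDerivAt_eR_phase Y ξ v)
    have h2 := (hG1 v hv).ofReal_comp.mul (hasDerivAt_eR_phase Y ξ v)
    refine ((h1.const_mul Complex.I).sub h2).congr_deriv ?_
    have h3 : (s v : ℂ) ≠ 0 := by exact_mod_cast hs0 v hv
    have h4 : ((2 * π * (Y * Real.exp v - ξ) : ℝ) : ℂ) = (s v : ℂ) := rfl
    rw [h4]
    simp only [hP]
    push_cast
    field_simp
    linear_combination ((a v : ℂ) * (s v : ℂ) ^ 2 * eR (Y * Real.exp v - v * ξ)) * Complex.I_sq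
  have hcq : ContinuousOn (fun v => (s v)⁻¹) (Set.Icc (-3) 3) := hcs.continuousOn.inv₀ hs0
  have hcg : ContinuousOn g (Set.Icc (-3) 3) := by
    have : ContinuousOn (fun v => E v / s v) (Set.Icc (-3) 3) := hcE.continuousOn.div
      hcs.continuousOn hs0
    have h1 := hca.continuousOn (s := Set.Icc (-3 : ℝ) 3)
    have h2 := hca₁.continuousOn (s := Set.Icc (-3 : ℝ) 3)
    have h3 := ha₂.continuousOn (s := Set.Icc (-3 : ℝ) 3)
    fun_prop
  have hi1 : IntervalIntegrable (fun v => (a v : ℂ) * P v) volume (-3) 3 :=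
    (by fun_prop : Continuous _).intervalIntegrable _ _
  have hi2 : IntervalIntegrable (fun v => ((g v * (s v)⁻¹ ^ 2 : ℝ) : ℂ) * P v) volume (-3) 3 := by
    refine ContinuousOn.intervalIntegrable ?_
    rw [hI]
    exact (Complex.continuous_ofReal.comp_continuousOn (hcg.mul (hcq.pow 2))).mul hcP.continuousOn
  have hi1' : IntervalIntegrable (fun v => -((a v : ℂ) * P v)) volume (-3) 3 := hi1.neg
  have h3 := h0 3 (by norm_num)
  have h3' := h0 (-3) (by norm_num)
  have hint := intervalIntegral.integral_eq_sub_of_hasDerivAt (a := -3) (b := 3)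
    (fun v hv => hH v (hI ▸ hv)) (hi1'.sub hi2)
  simp only [hb, h3.1, h3.2, h3'.1, h3'.2] at hint
  rw [intervalIntegral.integral_sub hi1' hi2, intervalIntegral.integral_neg] at hint
  have hJ : ∫ v in (-3 : ℝ)..3, (a v : ℂ) * P v =
      -∫ v in (-3 : ℝ)..3, ((g v * (s v)⁻¹ ^ 2 : ℝ) : ℂ) * P v := by
    simp only [zero_mul, sub_zero, Complex.ofReal_zero, mul_zero] at hint
    linear_combination -hint
  rw [hJ, norm_neg]
  have hb6 : 126 * M * Real.exp 6 / (Y + |ξ|) ^ 2 =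
      21 * M * (Real.exp 6 / (Y + |ξ|) ^ 2) * |3 - (-3 : ℝ)| := by
    norm_num
    ring
  rw [hb6]
  refine intervalIntegral.norm_integral_le_of_norm_le_const fun v hv => ?_
  rw [Set.uIoc_of_le (by norm_num)] at hv
  replace hv := Set.Ioc_subset_Icc_self hv
  have hPn : ‖P v‖ = 1 := norm_eR _
  rw [norm_mul, hPn, mul_one, Complex.norm_real, Real.norm_eq_abs, abs_mul]
  have hr : |E v / s v| ≤ 2 := by
    rw [abs_div, abs_of_pos (hEpos v)]
    exact (div_le_iff₀ (abs_pos.2 (hs0 v hv))).2 (hs2 v hv)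
  have hr2 : (E v / s v) ^ 2 ≤ 4 := by
    rw [← sq_abs]
    nlinarith [abs_nonneg (E v / s v)]
  have hgb : |g v| ≤ 21 * M := by
    have b1 : |a₁ v * (E v / s v)| ≤ M * 2 := by
      rw [abs_mul]
      exact mul_le_mul (hM₁ v) hr (abs_nonneg _) hM0
    have b2 : |a v * (E v / s v)| ≤ M * 2 := by
      rw [abs_mul]
      exact mul_le_mul (hM v) hr (abs_nonneg _) hM0
    have b3 : |a v * (E v / s v) ^ 2| ≤ M * 4 := by
      rw [abs_mul, abs_of_nonneg (sq_nonneg (E v / s v))]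
      exact mul_le_mul (hM v) hr2 (sq_nonneg _) hM0
    have b4 := abs_le.1 (hM₂ v)
    rw [abs_le] at b1 b2 b3 ⊢
    simp only [hg]
    constructor <;> nlinarith
  refine mul_le_mul hgb ?_ (abs_nonneg _) (by positivity)
  rw [abs_pow, abs_inv]
  have h6 : Real.exp 6 = (Real.exp (-3))⁻¹ ^ 2 := by
    rw [← Real.exp_neg, ← Real.exp_nat_mul]
    norm_num
  rw [h6, div_eq_mul_inv, ← inv_pow, ← mul_pow, ← mul_inv]
  have := hs1 v hv
  gcongr

end OscillatoryIntegral

lemma integrable_inv_sq_add_sq {Y : ℝ} (hY : 0 < Y) :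
    Integrable (fun ξ : ℝ => (Y ^ 2 + ξ ^ 2)⁻¹) ∧ ∫ ξ : ℝ, (Y ^ 2 + ξ ^ 2)⁻¹ = π / Y := by
  have h : (fun ξ : ℝ => (Y ^ 2 + ξ ^ 2)⁻¹) =
      fun ξ : ℝ => (Y ^ 2)⁻¹ * (1 + (Y⁻¹ * ξ) ^ 2)⁻¹ := by
    ext ξ
    field_simp
  rw [h]
  refine ⟨((integrable_inv_one_add_sq).comp_mul_left' (inv_ne_zero hY.ne')).const_mul _, ?_⟩
  rw [integral_const_mul, Measure.integral_comp_mul_left (fun x : ℝ => (1 + x ^ 2)⁻¹) Y⁻¹,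
    integral_univ_inv_one_add_sq, inv_inv, abs_of_pos hY, smul_eq_mul]
  field_simp

lemma exists_kernel : ∃ C : ℝ, 0 < C ∧ ∀ Y : ℝ, 0 < Y → ∃ κ : ℝ → ℂ, Continuous κ ∧
    Integrable κ ∧ (∀ ξ, ‖κ ξ‖ ≤ C / √Y) ∧
    (∫ ξ in (Set.Icc (Real.exp (-4) * Y) (Real.exp 4 * Y))ᶜ, ‖κ ξ‖) ≤ C / Y ∧
    ∀ z ∈ Set.Icc (Y / 2) (3 * Y),
      ((√(z / Y) : ℝ) : ℂ) * eR z = ∫ ξ, κ ξ * eR (ξ * Real.log (z / Y)) := by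
  obtain ⟨a, a₁, a₂, M, hM0, ha, ha₁, ha₂, hM, hM₁, hM₂, h0, he⟩ := exists_amplitude
  have hca : Continuous a := continuous_iff_continuousAt.2 fun v => (ha v).continuousAt
  have hca₁ : Continuous a₁ := continuous_iff_continuousAt.2 fun v => (ha₁ v).continuousAt
  have hpi := Real.pi_pos
  set C₁ := (6 + (1 + Real.exp 3) * π) * M with hC₁
  set C₂ := 126 * M * Real.exp 6 with hC₂
  refine ⟨C₁ + C₂ * π, by positivity, fun Y hY => ?_⟩
  have hcR := continuous_eR
  set Φ : ℝ → ℂ := fun v => (a v : ℂ) * eR (Y * Real.exp v) with hΦ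
  have hΦc : Continuous Φ := by fun_prop
  have hΦs : HasCompactSupport Φ := by
    refine HasCompactSupport.intro (isCompact_Icc (a := (-3 : ℝ)) (b := 3)) fun v hv => ?_
    have : 3 ≤ |v| := by
      by_contra h
      exact hv (abs_le.1 (not_le.1 h).le)
    simp [hΦ, (h0 v this).1]
  have hΦi : Integrable Φ := hΦc.integrable_of_hasCompactSupport hΦs
  have hκ : ∀ ξ, 𝓕 Φ ξ = ∫ v in (-3 : ℝ)..3, (a v : ℂ) * eR (Y * Real.exp v - v * ξ) := by
    intro ξ
    rw [fourier_eq_integral_eR, intervalIntegral.integral_eq_integral_of_support_subset]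
    · refine integral_congr_ae (Filter.Eventually.of_forall fun v => ?_)
      simp only [hΦ, sub_eq_add_neg, eR_add]
      ring
    · intro v hv
      have : ¬ 3 ≤ |v| := fun h => hv (by simp [(h0 v h).1])
      have h1 := abs_lt.1 (not_le.1 this)
      exact ⟨h1.1, h1.2.le⟩
  have hκc : Continuous (𝓕 Φ) := VectorFourier.fourierIntegral_continuous
    Real.continuous_fourierChar (by fun_prop) hΦi
  set J := Set.Icc (Real.exp (-4) * Y) (Real.exp 4 * Y) with hJ
  have hJm : MeasurableSet Jᶜ := measurableSet_Icc.compl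
  obtain ⟨hi, hiv⟩ := integrable_inv_sq_add_sq hY
  have htail : ∀ ξ ∈ Jᶜ, ‖𝓕 Φ ξ‖ ≤ C₂ * (Y ^ 2 + ξ ^ 2)⁻¹ := fun ξ hξ => by
    rw [hκ]
    refine (norm_oscillatory_le_of_notMem ha ha₁ ha₂ hM hM₁ hM₂ h0 hY hξ).trans ?_
    rw [← div_eq_mul_inv]
    refine div_le_div_of_nonneg_left (by positivity) (by positivity) ?_
    nlinarith [sq_abs ξ, abs_nonneg ξ]
  have hit : IntegrableOn (𝓕 Φ) Jᶜ := Integrable.mono' (hi.const_mul C₂).integrableOn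
    hκc.aestronglyMeasurable ((ae_restrict_iff' hJm).2 (Filter.Eventually.of_forall htail))
  have hκi : Integrable (𝓕 Φ) := by
    rw [← integrableOn_univ, ← Set.union_compl_self J]
    exact (hκc.continuousOn.integrableOn_compact isCompact_Icc).union hit
  refine ⟨𝓕 Φ, hκc, hκi, fun ξ => ?_, ?_, fun z hz => ?_⟩
  · rw [hκ]
    refine (norm_oscillatory_le ha hca₁ hM hM₁ (fun v hv => (h0 v hv).1) hY ξ).trans ?_
    gcongr
    have : 0 ≤ C₂ * π := by positivity
    linarith
  · calc ∫ ξ in Jᶜ, ‖𝓕 Φ ξ‖ ≤ ∫ ξ in Jᶜ, C₂ * (Y ^ 2 + ξ ^ 2)⁻¹ :=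
          setIntegral_mono_on hit.norm (hi.const_mul C₂).integrableOn hJm htail
      _ ≤ ∫ ξ, C₂ * (Y ^ 2 + ξ ^ 2)⁻¹ := setIntegral_le_integral (hi.const_mul C₂)
          (Filter.Eventually.of_forall fun ξ => by
            change 0 ≤ C₂ * (Y ^ 2 + ξ ^ 2)⁻¹
            positivity)
      _ = C₂ * π / Y := by rw [integral_const_mul, hiv, mul_div_assoc]
      _ ≤ _ := by
        gcongr
        have : 0 ≤ C₁ := by positivity
        linarith
  · have hz0 : 0 < z := by linarith [hz.1]
    have hzY : 0 < z / Y := div_pos hz0 hY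
    set v := Real.log (z / Y) with hv
    have hev : Real.exp v = z / Y := Real.exp_log hzY
    have hv2 : |v| ≤ 2 := by
      have h1 : (3 : ℝ) ≤ Real.exp 2 := by
        have := Real.add_one_le_exp (2 : ℝ)
        linarith
      have h2 : Real.exp (-2) ≤ 1 / 2 := by
        rw [Real.exp_neg, one_div]
        exact inv_anti₀ (by norm_num) (by linarith)
      rw [abs_le]
      constructor
      · rw [hv, Real.le_log_iff_exp_le hzY, le_div_iff₀ hY]
        nlinarith [hz.1]
      · rw [hv, Real.log_le_iff_le_exp hzY, div_le_iff₀ hY]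
        nlinarith [hz.2]
    have h1 : Φ v = ((√(z / Y) : ℝ) : ℂ) * eR z := by
      simp only [hΦ]
      rw [he v hv2, hev, mul_div_cancel₀ _ hY.ne', ← hev, Real.sqrt_eq_rpow, ← Real.exp_mul]
      congr 4
      ring
    rw [← h1, ← congr_fun (hΦc.fourierInv_fourier_eq hΦi hκi) v, Real.fourierInv_eq']
    refine integral_congr_ae (Filter.Eventually.of_forall fun ξ => ?_)
    simp only [smul_eq_mul]
    rw [mul_comm, eR_eq_exp]
    congr 3
    simp
    ring

section FiniteSupport

variable {f : ℕ → ℂ} {N : Finset ℕ}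

lemma expSumR_eq_sum (hN : ∀ n, f n ≠ 0 → n ∈ N) (θ : ℝ) :
    expSumR f θ = ∑ n ∈ N, f n * eR (θ * n) :=
  finsum_eq_sum_of_support_subset _ fun n hn => hN n fun h => hn (by simp [h])

lemma dirPoly_eq_sum (hN : ∀ n, f n ≠ 0 → n ∈ N) (s : ℂ) :
    dirPoly f s = ∑ n ∈ N, f n / (n : ℂ) ^ s :=
  finsum_eq_sum_of_support_subset _ fun n hn => hN n fun h => hn (by simp [h])

lemma continuous_dirPoly_line (hN : ∀ n, f n ≠ 0 → n ∈ N) (h0 : f 0 = 0) :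
    Continuous fun t : ℝ => dirPoly f (1 / 2 + Complex.I * (t : ℂ)) := by
  simp only [dirPoly_eq_sum hN]
  refine continuous_finsetSum _ fun n _ => ?_
  rcases eq_or_ne n 0 with rfl | hn
  · simpa [h0] using continuous_const
  · have hn' : (n : ℂ) ≠ 0 := by exact_mod_cast hn
    refine continuous_const.div (Continuous.const_cpow (by fun_prop) (Or.inl hn')) fun t => ?_
    simp [Complex.cpow_eq_zero_iff, hn']

lemma integrable_count_restrict {E : Type*} [NormedAddCommGroup E] (N : Finset ℕ) (a : ℕ → E) :
    Integrable a (Measure.count.restrict (N : Set ℕ)) := by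
  have : IsFiniteMeasure (Measure.count.restrict (N : Set ℕ)) := ⟨by
    rw [Measure.restrict_apply_univ, Measure.count_apply_finset]
    simp⟩
  refine Integrable.of_bound (C := ∑ n ∈ N, ‖a n‖) (by fun_prop) ?_
  rw [ae_restrict_iff' N.measurableSet]
  exact Filter.Eventually.of_forall fun n hn =>
    Finset.single_le_sum (f := fun n => ‖a n‖) (fun _ _ => norm_nonneg _) hn

lemma integral_count_restrict {E : Type*} [NormedAddCommGroup E] [NormedSpace ℝ E]
    [CompleteSpace E] (N : Finset ℕ) (a : ℕ → E) :
    ∫ n, a n ∂(Measure.count.restrict (N : Set ℕ)) = ∑ n ∈ N, a n := by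
  rw [setIntegral_finset N (integrable_count_restrict N a)]
  simp [Measure.real]

lemma sum_Icc_floor_eq (hN : ∀ n, f n ≠ 0 → n ∈ N) (h0 : f 0 = 0) (x L : ℝ) :
    ∑ n ∈ Finset.Icc ⌈x⌉₊ ⌊x + L⌋₊, ‖f n‖ =
      ∑ n ∈ N.filter (fun n : ℕ => x ≤ (n : ℝ) ∧ (n : ℝ) ≤ x + L), ‖f n‖ := by
  have key : ∀ n : ℕ, f n ≠ 0 → (n ∈ Finset.Icc ⌈x⌉₊ ⌊x + L⌋₊ ↔
      n ∈ N.filter fun n : ℕ => x ≤ (n : ℝ) ∧ (n : ℝ) ≤ x + L) := by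
    intro n hn
    have hn0 : n ≠ 0 := fun h => hn (h ▸ h0)
    rw [Finset.mem_Icc, Finset.mem_filter, Nat.ceil_le, Nat.le_floor_iff' hn0]
    simp [hN n hn]
  refine Finset.sum_congr_of_eq_on_inter (fun n h1 h2 => ?_) (fun n h1 h2 => ?_)
    fun _ _ _ => rfl
  · by_contra h
    have h' : f n ≠ 0 := fun h3 => h (by simp [h3])
    exact h2 ((key n h').1 h1)
  · by_contra h
    have h' : f n ≠ 0 := fun h3 => h (by simp [h3])
    exact h2 ((key n h').2 h1)

lemma setIntegral_count_window (a : ℕ → ℂ) (x L : ℝ) :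
    ∫ n in {n : ℕ | x ≤ (n : ℝ) ∧ (n : ℝ) ≤ x + L}, ‖a n‖
      ∂(Measure.count.restrict (N : Set ℕ)) =
      ∑ n ∈ N.filter (fun n : ℕ => x ≤ (n : ℝ) ∧ (n : ℝ) ≤ x + L), ‖a n‖ := by
  rw [Measure.restrict_restrict (MeasurableSet.of_discrete), ← integral_count_restrict]
  congr 2
  ext n
  simp [and_comm]

lemma integrable_sum_window_sq (hN : ∀ n, f n ≠ 0 → n ∈ N) (h0 : f 0 = 0) {L : ℝ} (hL : 0 < L) :
    Integrable fun x : ℝ => (∑ n ∈ Finset.Icc ⌈x⌉₊ ⌊x + L⌋₊, ‖f n‖) ^ 2 := by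
  have h := integrable_window_sq (integrable_count_restrict N f)
    (measurable_of_countable fun n : ℕ => (n : ℝ)) hL
  simpa only [setIntegral_count_window, ← sum_Icc_floor_eq hN h0] using h

lemma integral_norm_expSumR_sq_le (hN : ∀ n, f n ≠ 0 → n ∈ N) (h0 : f 0 = 0) {H : ℝ}
    (hH : 0 < H) (β : ℝ) :
    ∫ θ in (β - 1 / H)..(β + 1 / H), ‖expSumR f θ‖ ^ 2 ≤
      144 / H ^ 2 * ∫ x : ℝ, (∑ n ∈ Finset.Icc ⌈x⌉₊ ⌊x + H⌋₊, ‖f n‖) ^ 2 := by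
  have h := gallagher (integrable_count_restrict N fun n => f n * eR (β * n))
    (measurable_of_countable fun n : ℕ => (n : ℝ)) (L := H / 6) (U := 1 / H) (by positivity)
    (by positivity) (by
      apply le_of_eq
      field_simp)
  have e1 : ∫ θ in (β - 1 / H)..(β + 1 / H), ‖expSumR f θ‖ ^ 2 =
      ∫ u in (-(1 / H))..(1 / H), ‖∫ n, (fun n : ℕ => f n * eR (β * n)) n * eR (u * (n : ℝ))
        ∂(Measure.count.restrict (N : Set ℕ))‖ ^ 2 := by
    rw [sub_eq_add_neg, ← intervalIntegral.integral_comp_add_left]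
    refine intervalIntegral.integral_congr fun u _ => ?_
    simp only [integral_count_restrict, expSumR_eq_sum hN, add_mul, eR_add, mul_assoc]
  rw [e1]
  refine h.trans ?_
  have e2 : 4 / (H / 6) ^ 2 = 144 / H ^ 2 := by
    field_simp
    norm_num
  rw [e2]
  refine mul_le_mul_of_nonneg_left ?_ (by positivity)
  refine integral_mono (integrable_window_sq (integrable_count_restrict N _)
    (measurable_of_countable fun n : ℕ => (n : ℝ)) (by positivity))
    (integrable_sum_window_sq hN h0 hH) fun x => ?_
  simp only [setIntegral_count_window, sum_Icc_floor_eq hN h0, norm_mul, norm_eR, mul_one]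
  refine pow_le_pow_left₀ (Finset.sum_nonneg fun _ _ => norm_nonneg _) ?_ 2
  refine Finset.sum_le_sum_of_subset_of_nonneg (fun n hn => ?_) fun _ _ _ => norm_nonneg _
  rw [Finset.mem_filter] at hn ⊢
  exact ⟨hn.1, hn.2.1, by linarith [hn.2.2]⟩

lemma sq_sum_norm_le {X H : ℝ} (hH : 0 < H) (hHX : H ≤ X)
    (hf : ∀ n : ℕ, f n ≠ 0 → X < (n : ℝ) ∧ (n : ℝ) ≤ 2 * X)
    (hN : ∀ n, f n ≠ 0 → n ∈ N) (h0 : f 0 = 0) :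
    (∑ n ∈ N, ‖f n‖) ^ 2 ≤
      2 * X / H ^ 2 * ∫ x : ℝ, (∑ n ∈ Finset.Icc ⌈x⌉₊ ⌊x + H⌋₊, ‖f n‖) ^ 2 := by
  set S : ℝ → ℝ := fun x => ∑ n ∈ Finset.Icc ⌈x⌉₊ ⌊x + H⌋₊, ‖f n‖ with hS
  set T := ∑ n ∈ N, ‖f n‖ with hT
  have hX : 0 < X := hH.trans_le hHX
  have hS' : S = fun x => ∑ n ∈ N, (Set.Icc ((n : ℝ) - H) n).indicator (fun _ => ‖f n‖) x := by
    ext x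
    rw [hS]
    change ∑ n ∈ Finset.Icc ⌈x⌉₊ ⌊x + H⌋₊, ‖f n‖ = _
    rw [sum_Icc_floor_eq hN h0, Finset.sum_filter]
    refine Finset.sum_congr rfl fun n _ => ?_
    rw [Set.indicator_apply]
    congr 1
    rw [Set.mem_Icc, sub_le_iff_le_add, and_comm]
  have hi : ∀ n ∈ N, Integrable ((Set.Icc ((n : ℝ) - H) n).indicator (fun _ => ‖f n‖)) :=
    fun n _ => (integrable_indicator_iff measurableSet_Icc).2
      (integrableOn_const (by simp))
  have hSi : Integrable S := by
    rw [hS']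
    exact integrable_finsetSum _ hi
  have hSint : ∫ x, S x = H * T := by
    rw [hS', integral_finsetSum _ hi, hT, Finset.mul_sum]
    refine Finset.sum_congr rfl fun n _ => ?_
    rw [integral_indicator measurableSet_Icc]
    simp [hH.le]
  have hS0 : ∀ x, x ∉ Set.Icc (X - H) (2 * X) → S x = 0 := by
    intro x hx
    rw [hS']
    refine Finset.sum_eq_zero fun n _ => ?_
    by_contra h
    rw [← ne_eq, Set.indicator_apply_ne_zero] at h
    have h1 : f n ≠ 0 := fun h' => h.2 (by simp [h'])
    exact hx ⟨by linarith [h.1.1, h.1.2, (hf n h1).1], h.1.2.trans (hf n h1).2⟩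
  set lam := H * T / (X + H) with hlam
  have hmono := integral_mono (f := fun x => 2 * lam * S x -
      (Set.Icc (X - H) (2 * X)).indicator (fun _ => lam ^ 2) x) (g := fun x => S x ^ 2)
    ((hSi.const_mul _).sub ((integrable_indicator_iff measurableSet_Icc).2
      (integrableOn_const (by simp)))) (integrable_sum_window_sq hN h0 hH) (fun x => by
    change 2 * lam * S x - (Set.Icc (X - H) (2 * X)).indicator (fun _ => lam ^ 2) x ≤ S x ^ 2
    by_cases hx : x ∈ Set.Icc (X - H) (2 * X)
    · rw [Set.indicator_of_mem hx]
      nlinarith [sq_nonneg (S x - lam)]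
    · rw [Set.indicator_of_notMem hx, hS0 x hx]
      simp)
  rw [integral_sub (hSi.const_mul _) ((integrable_indicator_iff measurableSet_Icc).2
      (integrableOn_const (by simp))), integral_const_mul, hSint,
    integral_indicator measurableSet_Icc] at hmono
  have h2 : ∫ _ in Set.Icc (X - H) (2 * X), lam ^ 2 = (X + H) * lam ^ 2 := by
    simp only [integral_const, smul_eq_mul, measureReal_restrict_apply_univ,
      Real.volume_real_Icc]
    rw [max_eq_left (by linarith)]
    ring
  rw [h2] at hmono
  have h3 : 2 * lam * (H * T) - (X + H) * lam ^ 2 = (H * T) ^ 2 / (X + H) := by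
    have : X + H ≠ 0 := by positivity
    rw [hlam]
    field_simp
    ring
  rw [h3, div_le_iff₀ (by positivity)] at hmono
  have hW : 0 ≤ ∫ x, S x ^ 2 := integral_nonneg fun x => sq_nonneg _
  rw [div_mul_eq_mul_div, le_div_iff₀ (by positivity)]
  nlinarith

end FiniteSupport

section StationaryPhase

lemma inv_natCast_cpow_half_line {n : ℕ} (hn : n ≠ 0) (ξ : ℝ) :
    ((n : ℂ) ^ (1 / 2 + Complex.I * ((-(2 * π * ξ) : ℝ) : ℂ)))⁻¹ =
      (((√n)⁻¹ : ℝ) : ℂ) * eR (ξ * Real.log n) := by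
  have hn' : (n : ℂ) ≠ 0 := by exact_mod_cast hn
  have hs : √(n : ℝ) = Real.exp (Real.log n / 2) := by
    rw [Real.exp_half, Real.exp_log (by positivity)]
  rw [hs, ← Real.exp_neg, Complex.ofReal_exp, eR, Complex.cpow_def_of_ne_zero hn',
    ← Complex.exp_neg, ← Complex.exp_add, ← Complex.natCast_log]
  congr 1
  push_cast
  ring

lemma integrable_mul_eR {μ : Measure ℝ} {κ : ℝ → ℂ} (hκ : Integrable κ μ) {g : ℝ → ℝ}
    (hg : Continuous g) : Integrable (fun ξ => κ ξ * eR (g ξ)) μ :=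
  hκ.norm.mono' (hκ.aestronglyMeasurable.mul (continuous_eR.comp hg).aestronglyMeasurable)
    (Filter.Eventually.of_forall fun ξ => by simp [norm_eR])

variable {f : ℕ → ℂ} {N : Finset ℕ} {κ : ℝ → ℂ} {X Y : ℝ}

lemma norm_dirPoly_half_line_le (hX : 0 < X) (hf : ∀ n : ℕ, f n ≠ 0 → X < (n : ℝ))
    (hN : ∀ n, f n ≠ 0 → n ∈ N) (ξ : ℝ) :
    ‖dirPoly f (1 / 2 + Complex.I * ((-(2 * π * ξ) : ℝ) : ℂ))‖ ≤ (∑ n ∈ N, ‖f n‖) / √X := by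
  rw [dirPoly_eq_sum hN, Finset.sum_div]
  refine norm_sum_le_of_le _ fun n _ => ?_
  by_cases h : f n = 0
  · simp [h]
  have hn : n ≠ 0 := fun h' => by
    have := hf n h
    rw [h', Nat.cast_zero] at this
    linarith
  rw [div_eq_mul_inv, inv_natCast_cpow_half_line hn, norm_mul, norm_mul, norm_eR, mul_one,
    Complex.norm_real, Real.norm_of_nonneg (by positivity), ← div_eq_mul_inv]
  have := (hf n h).le
  gcongr

lemma expSumR_eq_integral_kernel (hX : 0 < X) (hY : 0 < Y)
    (hf : ∀ n : ℕ, f n ≠ 0 → X < (n : ℝ)) (hN : ∀ n, f n ≠ 0 → n ∈ N) (hκ : Integrable κ)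
    (hrep : ∀ z ∈ Set.Icc (Y / 2) (3 * Y),
      ((√(z / Y) : ℝ) : ℂ) * eR z = ∫ ξ, κ ξ * eR (ξ * Real.log (z / Y)))
    {θ : ℝ} (hθ : 0 < θ) (hθn : ∀ n : ℕ, f n ≠ 0 → θ * n ∈ Set.Icc (Y / 2) (3 * Y)) :
    expSumR f θ = ((√(Y / θ) : ℝ) : ℂ) * ∫ ξ, κ ξ *
      dirPoly f (1 / 2 + Complex.I * ((-(2 * π * ξ) : ℝ) : ℂ)) * eR (ξ * Real.log (θ / Y)) := by
  have hn0 : ∀ n, f n ≠ 0 → n ≠ 0 := fun n h h' => by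
    have := hf n h
    rw [h', Nat.cast_zero] at this
    linarith
  have hterm : ∀ n : ℕ, ∀ ξ : ℝ, κ ξ * (f n / (n : ℂ) ^
      (1 / 2 + Complex.I * ((-(2 * π * ξ) : ℝ) : ℂ))) * eR (ξ * Real.log (θ / Y)) =
      f n * (((√n)⁻¹ : ℝ) : ℂ) * (κ ξ * eR (ξ * Real.log (θ * n / Y))) := by
    intro n ξ
    by_cases h : f n = 0
    · simp [h]
    have hn : (0 : ℝ) < n := hX.trans (hf n h)
    have : θ * n / Y = n * (θ / Y) := by ring
    rw [div_eq_mul_inv (f n), inv_natCast_cpow_half_line (hn0 n h), this,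
      Real.log_mul hn.ne' (by positivity), mul_add, eR_add]
    ring
  simp only [dirPoly_eq_sum hN, Finset.mul_sum, Finset.sum_mul, hterm]
  rw [integral_finsetSum _ fun n _ => (integrable_mul_eR hκ (by fun_prop)).const_mul _,
    Finset.mul_sum, expSumR_eq_sum hN]
  refine Finset.sum_congr rfl fun n _ => ?_
  by_cases h : f n = 0
  · simp [h]
  have hn : (0 : ℝ) < n := hX.trans (hf n h)
  rw [integral_const_mul, ← hrep _ (hθn n h)]
  have h1 : √(Y / θ) * (√n)⁻¹ * √(θ * n / Y) = 1 := by
    rw [Real.sqrt_div hY.le, Real.sqrt_div (by positivity), Real.sqrt_mul hθ.le]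
    have := Real.sqrt_pos.2 hY
    have := Real.sqrt_pos.2 hθ
    have := Real.sqrt_pos.2 hn
    field_simp
  have h2 : ((√(Y / θ) : ℝ) : ℂ) * (((√n)⁻¹ : ℝ) : ℂ) * ((√(θ * n / Y) : ℝ) : ℂ) = 1 := by
    exact_mod_cast h1
  linear_combination (-(f n * eR (θ * n))) * h2

lemma integral_comp_log_div_le {h : ℝ → ℝ} (hc : Continuous h) (h0 : ∀ w, 0 ≤ h w) {β δ : ℝ}
    (hβ : 0 < β) (hδ : 0 < δ) (hδβ : δ ≤ β / 2) :
    ∫ θ in (β - δ)..(β + δ), h (Real.log (θ / β)) * θ⁻¹ ≤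
      ∫ w in (-(2 * δ / β))..(2 * δ / β), h w := by
  have hu : Set.uIcc (β - δ) (β + δ) = Set.Icc (β - δ) (β + δ) := Set.uIcc_of_le (by linarith)
  have hpos : ∀ θ ∈ Set.uIcc (β - δ) (β + δ), 0 < θ := fun θ hθ => by
    rw [hu] at hθ
    linarith [hθ.1]
  have hd : ∀ θ ∈ Set.uIcc (β - δ) (β + δ),
      HasDerivAt (fun θ => Real.log (θ / β)) θ⁻¹ θ := fun θ hθ => by
    have := hpos θ hθ
    refine (((hasDerivAt_id θ).div_const β).log (div_pos this hβ).ne').congr_deriv ?_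
    simp only [id]
    field_simp
  have h1 := intervalIntegral.integral_comp_mul_deriv hd
    (continuousOn_inv₀.mono fun θ hθ => (hpos θ hθ).ne') hc
  simp only [Function.comp_def] at h1
  rw [h1]
  have hq : 0 < δ / β := div_pos hδ hβ
  have hq2 : δ / β ≤ 1 / 2 := by
    rw [div_le_iff₀ hβ]
    linarith
  have e1 : (β - δ) / β = 1 - δ / β := by field_simp
  have e2 : (β + δ) / β = 1 + δ / β := by field_simp
  have e3 : 2 * δ / β = 2 * (δ / β) := by ring
  rw [e1, e2, e3]
  have l1 : Real.log (1 + δ / β) ≤ 2 * (δ / β) := by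
    have := Real.log_le_sub_one_of_pos (by linarith : 0 < 1 + δ / β)
    linarith
  have l2 : -(2 * (δ / β)) ≤ Real.log (1 - δ / β) := by
    refine le_trans ?_ (Real.one_sub_inv_le_log_of_pos (by linarith : 0 < 1 - δ / β))
    have : (1 - δ / β)⁻¹ ≤ 1 + 2 * (δ / β) := by
      rw [inv_le_iff_one_le_mul₀ (by linarith)]
      nlinarith
    linarith
  have l3 : Real.log (1 - δ / β) ≤ Real.log (1 + δ / β) :=
    Real.log_le_log (by linarith) (by linarith)
  exact intervalIntegral.integral_mono_interval l2 l3 l1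
    (Filter.Eventually.of_forall h0) (hc.intervalIntegrable _ _)

lemma continuous_integral_mul_eR {μ : Measure ℝ} {A : ℝ → ℂ} (hA : Integrable A μ) :
    Continuous fun w : ℝ => ∫ ξ, A ξ * eR (w * ξ) ∂μ := by
  refine continuous_of_dominated (bound := fun ξ => ‖A ξ‖)
    (fun w => (integrable_mul_eR hA (by fun_prop)).aestronglyMeasurable)
    (fun w => Filter.Eventually.of_forall fun ξ => by simp [norm_eR]) hA.norm
    (Filter.Eventually.of_forall fun ξ => ?_)
  exact continuous_const.mul (continuous_eR.comp (by fun_prop))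

end StationaryPhase

lemma integrableOn_sq_integral_window {d : ℝ → ℝ} (hd : Continuous d) {η Y : ℝ} (Z : ℝ) :
    MeasurableSet {t : ℝ | η * Y ≤ |t| ∧ |t| ≤ Y / η} ∧
    IntegrableOn (fun t => (∫ t' in (t - Z)..(t + Z), d t') ^ 2)
      {t : ℝ | η * Y ≤ |t| ∧ |t| ≤ Y / η} := by
  have hcl : IsClosed {t : ℝ | η * Y ≤ |t| ∧ |t| ≤ Y / η} :=
    (isClosed_le continuous_const continuous_abs).inter
      (isClosed_le continuous_abs continuous_const)
  refine ⟨hcl.measurableSet, ContinuousOn.integrableOn_compact ?_ (Continuous.continuousOn ?_)⟩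
  · refine (isCompact_Icc (a := -(Y / η)) (b := Y / η)).of_isClosed_subset hcl fun t ht => ?_
    exact abs_le.1 ht.2
  · refine Continuous.pow ?_ 2
    have h : (fun t => ∫ t' in (t - Z)..(t + Z), d t') =
        fun t => (∫ t' in (0 : ℝ)..(t + Z), d t') - ∫ t' in (0 : ℝ)..(t - Z), d t' := by
      ext t
      rw [intervalIntegral.integral_interval_sub_left] <;> exact hd.intervalIntegrable _ _
    rw [h]
    have hp := intervalIntegral.continuous_primitive (μ := volume) (fun a b => hd.intervalIntegrable a b) 0
    exact (hp.comp (by fun_prop)).sub (hp.comp (by fun_prop))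

lemma integral_sq_window_le {d : ℝ → ℝ} (hd : Continuous d) (hd0 : ∀ t, 0 ≤ d t) {η Y Z : ℝ}
    (hZ : 0 < Z) (hZY : Z ≤ Y) (hη : 0 < η) (hη' : η ≤ Real.exp (-4) / 10) :
    ∫ x, (∫ ω in {ω : ℝ | x ≤ ω ∧ ω ≤ x + Real.exp (-4) / 10 * Z}, d (-(2 * π * ω))
      ∂(volume.restrict (Set.Icc (Real.exp (-4) * Y) (Real.exp 4 * Y)))) ^ 2 ≤
    ∫ t in {t : ℝ | η * Y ≤ |t| ∧ |t| ≤ Y / η}, (∫ t' in (t - Z)..(t + Z), d t') ^ 2 := by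
  have hp3 := Real.pi_gt_three
  have hp4 := Real.pi_lt_d2
  have hm4 := Real.exp_pos (-4)
  have hm4' : Real.exp (-4) ≤ 1 := Real.exp_le_one_iff.2 (by norm_num)
  have hY : 0 < Y := hZ.trans_le hZY
  have hee : Real.exp (-4) * Real.exp 4 = 1 := by rw [← Real.exp_add]; norm_num
  set q := Real.exp (-4) / 10 with hq
  have hqp : 0 < q := by positivity
  set I := {t : ℝ | η * Y ≤ |t| ∧ |t| ≤ Y / η} with hI
  set Q : ℝ → ℝ := fun t => (∫ t' in (t - Z)..(t + Z), d t') ^ 2 with hQ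
  obtain ⟨hIm, hQi⟩ := integrableOn_sq_integral_window hd (η := η) (Y := Y) Z
  have hRi : Integrable (I.indicator Q) := (integrable_indicator_iff hIm).2 hQi
  have hR0 : ∀ t, 0 ≤ I.indicator Q t := fun t =>
    Set.indicator_nonneg (fun _ _ => sq_nonneg _) t
  have hR : ∫ x, I.indicator Q (-(2 * π) * x) ≤ ∫ t in I, Q t := by
    rw [Measure.integral_comp_mul_left, integral_indicator hIm, smul_eq_mul]
    refine mul_le_of_le_one_left (integral_nonneg fun t => sq_nonneg _) ?_
    rw [abs_inv, abs_neg, abs_of_pos (by positivity)]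
    exact inv_le_one_of_one_le₀ (by linarith)
  refine le_trans ?_ hR
  refine integral_mono_of_nonneg (Filter.Eventually.of_forall fun x => sq_nonneg _)
    (hRi.comp_mul_left' (by simp [Real.pi_ne_zero])) (Filter.Eventually.of_forall fun x => ?_)
  change (∫ ω in {ω : ℝ | x ≤ ω ∧ ω ≤ x + q * Z}, d (-(2 * π * ω))
      ∂(volume.restrict (Set.Icc (Real.exp (-4) * Y) (Real.exp 4 * Y)))) ^ 2 ≤
      I.indicator Q (-(2 * π) * x)
  have hset : {ω : ℝ | x ≤ ω ∧ ω ≤ x + q * Z} = Set.Icc x (x + q * Z) := rfl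
  have hdc : Continuous fun ω : ℝ => d (-(2 * π * ω)) := hd.comp (by fun_prop)
  rw [hset, Measure.restrict_restrict measurableSet_Icc]
  rcases (Set.Icc x (x + q * Z) ∩ Set.Icc (Real.exp (-4) * Y) (Real.exp 4 * Y)).eq_empty_or_nonempty
    with he | ⟨ω, ⟨hω1, hω2⟩, hω3, hω4⟩
  · rw [he]
    simpa using hR0 (-(2 * π) * x)
  have hqZ : q * Z ≤ Real.exp (-4) / 10 * Y := by gcongr
  have hx1 : Real.exp (-4) * Y * (9 / 10) ≤ x := by linarith
  have hx2 : x ≤ Real.exp 4 * Y := hω1.trans hω4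
  have hx0 : 0 < x := lt_of_lt_of_le (by positivity) hx1
  have hxI : -(2 * π) * x ∈ I := by
    have habs : |-(2 * π) * x| = 2 * π * x := by
      rw [abs_mul, abs_neg, abs_of_pos (by positivity : 0 < 2 * π), abs_of_pos hx0]
    change _ ≤ |_| ∧ |_| ≤ _
    rw [habs, le_div_iff₀ hη]
    constructor
    · have : η * Y ≤ Real.exp (-4) / 10 * Y := by gcongr
      nlinarith
    · calc 2 * π * x * η ≤ 2 * π * (Real.exp 4 * Y) * (Real.exp (-4) / 10) := by gcongr
        _ = (2 * π / 10) * Y * (Real.exp (-4) * Real.exp 4) := by ring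
        _ ≤ 1 * Y * (Real.exp (-4) * Real.exp 4) := by
          gcongr
          linarith
        _ = Y := by rw [hee]; ring
  rw [Set.indicator_of_mem hxI]
  refine pow_le_pow_left₀ (integral_nonneg fun _ => hd0 _) ?_ 2
  have h1 : ∫ ω in Set.Icc x (x + q * Z) ∩ Set.Icc (Real.exp (-4) * Y) (Real.exp 4 * Y),
      d (-(2 * π * ω)) ≤ ∫ ω in Set.Icc x (x + q * Z), d (-(2 * π * ω)) :=
    setIntegral_mono_set (hdc.continuousOn.integrableOn_compact isCompact_Icc)
      (Filter.Eventually.of_forall fun _ => hd0 _) (Set.inter_subset_left.eventuallyLE)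
  have h2 : ∫ ω in Set.Icc x (x + q * Z), d (-(2 * π * ω)) =
      (2 * π)⁻¹ * ∫ t' in (-(2 * π) * (x + q * Z))..(-(2 * π) * x), d t' := by
    rw [integral_Icc_eq_integral_Ioc, ← intervalIntegral.integral_of_le
      (by linarith [mul_pos hqp hZ])]
    have := intervalIntegral.integral_comp_mul_left (a := x) (b := x + q * Z) d
      (by simp [Real.pi_ne_zero] : -(2 * π) ≠ 0)
    rw [smul_eq_mul] at this
    rw [intervalIntegral.integral_symm (-(2 * π) * x), mul_neg, ← neg_mul, ← inv_neg, ← this]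
    simp only [neg_mul]
  have hqZ' : 2 * π * (q * Z) ≤ Z := by
    calc 2 * π * (q * Z) = (2 * π / 10) * Real.exp (-4) * Z := by rw [hq]; ring
      _ ≤ 1 * 1 * Z := by
        gcongr
        linarith
      _ = Z := by ring
  have h3 : ∫ t' in (-(2 * π) * (x + q * Z))..(-(2 * π) * x), d t' ≤
      ∫ t' in (-(2 * π) * x - Z)..(-(2 * π) * x + Z), d t' := by
    refine intervalIntegral.integral_mono_interval (by linarith) ?_ (by linarith)
      (Filter.Eventually.of_forall hd0) (hd.intervalIntegrable _ _)
    have : 0 < 2 * π * (q * Z) := by positivity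
    linarith
  have h4 : 0 ≤ ∫ t' in (-(2 * π) * (x + q * Z))..(-(2 * π) * x), d t' :=
    intervalIntegral.integral_nonneg (by
      have : 0 < 2 * π * (q * Z) := by positivity
      linarith) fun _ _ => hd0 _
  refine h1.trans ?_
  rw [h2]
  refine le_trans (mul_le_of_le_one_left h4 ?_) h3
  exact inv_le_one_of_one_le₀ (by linarith)

lemma integral_sq_main_le {f : ℕ → ℂ} {N : Finset ℕ} {κ : ℝ → ℂ} {C H Y η β : ℝ}
    (hN : ∀ n, f n ≠ 0 → n ∈ N) (h0 : f 0 = 0) (hκc : Continuous κ)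
    (hκ : ∀ ξ, ‖κ ξ‖ ≤ C / √Y) (hH : 0 < H) (hβ : 0 < β) (hHY : β * H ≤ Y) (hη : 0 < η)
    (hη' : η ≤ Real.exp (-4) / 10) :
    ∫ w in (-(2 * (1 / H) / β))..(2 * (1 / H) / β),
      ‖∫ ξ in Set.Icc (Real.exp (-4) * Y) (Real.exp 4 * Y), κ ξ *
        dirPoly f (1 / 2 + Complex.I * ((-(2 * π * ξ) : ℝ) : ℂ)) * eR (ξ * Real.log (β / Y)) *
        eR (w * ξ)‖ ^ 2 ≤
      4 / (Real.exp (-4) / 10 * (β * H)) ^ 2 * (C ^ 2 / Y *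
        ∫ t in {t : ℝ | η * Y ≤ |t| ∧ |t| ≤ Y / η}, (∫ t' in (t - β * H)..(t + β * H),
          ‖dirPoly f (1 / 2 + Complex.I * (t' : ℂ))‖) ^ 2) := by
  set q := Real.exp (-4) / 10 with hq
  have hqp : 0 < q := by positivity
  have hZ : 0 < β * H := mul_pos hβ hH
  have hY : 0 < Y := hZ.trans_le hHY
  set J := Set.Icc (Real.exp (-4) * Y) (Real.exp 4 * Y) with hJ
  have hdc := continuous_dirPoly_line hN h0
  set G : ℝ → ℂ := fun ξ => dirPoly f (1 / 2 + Complex.I * ((-(2 * π * ξ) : ℝ) : ℂ)) with hG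
  have hGc : Continuous G := hdc.comp (by fun_prop : Continuous fun ξ : ℝ => -(2 * π * ξ))
  have hcR := continuous_eR
  have hGi : Integrable G (volume.restrict J) :=
    hGc.continuousOn.integrableOn_compact isCompact_Icc
  have hBi : Integrable (fun ξ => κ ξ * G ξ * eR (ξ * Real.log (β / Y))) (volume.restrict J) :=
    (by fun_prop : Continuous _).continuousOn.integrableOn_compact isCompact_Icc
  have hm4 : 6 * q ≤ 5 := by
    have : Real.exp (-4) ≤ 1 := Real.exp_le_one_iff.2 (by norm_num)
    linarith
  have hg := gallagher hBi (measurable_id (α := ℝ)) (L := q * (β * H)) (U := 2 * (1 / H) / β)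
    (by positivity) (by positivity) (by
      have e : q * (β * H) * (2 * (1 / H) / β) = 2 * q := by field_simp
      have h4 : (5 : ℝ) ≤ Real.exp 4 := by
        have := Real.add_one_le_exp (4 : ℝ)
        linarith
      have h5 : Real.exp (-4) ≤ 1 / 5 := by
        rw [Real.exp_neg, one_div]
        exact inv_anti₀ (by norm_num) h4
      rw [e]
      linarith)
  simp only [id] at hg
  refine hg.trans (mul_le_mul_of_nonneg_left ?_ (by positivity))
  refine le_trans ?_ (mul_le_mul_of_nonneg_left (integral_sq_window_le hdc.norm
    (fun _ => norm_nonneg _) hZ hHY hη hη') (by positivity))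
  rw [← integral_const_mul]
  have hwi := integrable_window_sq hGi (measurable_id (α := ℝ)) (L := q * (β * H)) (by positivity)
  refine integral_mono (integrable_window_sq hBi (measurable_id (α := ℝ)) (by positivity))
    (hwi.const_mul _) fun x => ?_
  have e : C ^ 2 / Y = (C / √Y) ^ 2 := by rw [div_pow, Real.sq_sqrt hY.le]
  simp only [e]
  rw [← mul_pow, ← integral_const_mul]
  refine pow_le_pow_left₀ (integral_nonneg fun _ => norm_nonneg _) ?_ 2
  refine integral_mono hBi.norm.restrict (hGi.norm.restrict.const_mul _) fun ξ => ?_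
  simp only [norm_mul, norm_eR, mul_one]
  exact mul_le_mul_of_nonneg_right (hκ ξ) (norm_nonneg _)

set_option maxHeartbeats 1000000 in
lemma stationary_phase_pos : ∃ C : ℝ, 0 < C ∧ ∀ H X : ℝ, 1 ≤ H → H ≤ X →
    ∀ f : ℕ → ℂ, (∀ n : ℕ, f n ≠ 0 → X < (n : ℝ) ∧ (n : ℝ) ≤ 2 * X) →
    ∀ β η : ℝ, 0 < β → 0 < η → η ≤ Real.exp (-4) / 10 →
      (∫ θ in (β - 1 / H)..(β + 1 / H), ‖expSumR f θ‖ ^ 2)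
        ≤ C * ((1 / (β ^ 2 * H ^ 2)) *
              (∫ t in {t : ℝ | η * β * X ≤ |t| ∧ |t| ≤ β * X / η},
                (∫ t' in (t - β * H)..(t + β * H),
                  ‖dirPoly f (1 / 2 + Complex.I * (t' : ℂ))‖) ^ 2)
            + ((η + 1 / (β * H)) ^ 2 / H ^ 2) *
              (∫ x : ℝ, (∑ n ∈ Finset.Icc ⌈x⌉₊ ⌊x + H⌋₊, ‖f n‖) ^ 2)) := by
  obtain ⟨C, hC, hker⟩ := exists_kernel
  have hq : 0 < Real.exp (-4) / 10 := by positivity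
  refine ⟨8 * C ^ 2 / (Real.exp (-4) / 10) ^ 2 + 16 * C ^ 2 + 576, by positivity, ?_⟩
  intro H X hH1 hHX f hf β η hβ hη hη'
  have hH : 0 < H := by linarith
  have hX : 0 < X := by linarith
  have hN : ∀ n, f n ≠ 0 → n ∈ Finset.range (⌊2 * X⌋₊ + 1) := fun n hn =>
    Finset.mem_range_succ_iff.2 (Nat.le_floor (hf n hn).2)
  have h0 : f 0 = 0 := by
    by_contra h
    have := (hf 0 h).1
    rw [Nat.cast_zero] at this
    linarith
  set N := Finset.range (⌊2 * X⌋₊ + 1) with hNdef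
  set Y := β * X with hYdef
  have hY : 0 < Y := mul_pos hβ hX
  have hI : {t : ℝ | η * β * X ≤ |t| ∧ |t| ≤ Y / η} = {t : ℝ | η * Y ≤ |t| ∧ |t| ≤ Y / η} := by
    rw [hYdef, mul_assoc]
  rw [hI]
  set A := ∫ t in {t : ℝ | η * Y ≤ |t| ∧ |t| ≤ Y / η}, (∫ t' in (t - β * H)..(t + β * H),
    ‖dirPoly f (1 / 2 + Complex.I * (t' : ℂ))‖) ^ 2 with hA
  set W := ∫ x : ℝ, (∑ n ∈ Finset.Icc ⌈x⌉₊ ⌊x + H⌋₊, ‖f n‖) ^ 2 with hW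
  have hA0 : 0 ≤ A := integral_nonneg fun _ => sq_nonneg _
  have hW0 : 0 ≤ W := integral_nonneg fun _ => sq_nonneg _
  set Z := β * H with hZdef
  have hZ : 0 < Z := mul_pos hβ hH
  have hZY : Z ≤ Y := mul_le_mul_of_nonneg_left hHX hβ.le
  set q := Real.exp (-4) / 10 with hqdef
  have hZ2 : β ^ 2 * H ^ 2 = Z ^ 2 := by rw [hZdef, mul_pow]
  rw [hZ2]
  rcases lt_or_ge Z 2 with hZlt | hZge
  · refine (integral_norm_expSumR_sq_le hN h0 hH β).trans ?_
    have h1 : 1 / 2 ≤ η + 1 / Z := by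
      have : 1 / 2 ≤ 1 / Z := one_div_le_one_div_of_le hZ hZlt.le
      linarith
    have h2 : 1 / 4 ≤ (η + 1 / Z) ^ 2 := by nlinarith
    calc 144 / H ^ 2 * W = 576 * ((1 / 4) / H ^ 2 * W) := by ring
      _ ≤ 576 * ((η + 1 / Z) ^ 2 / H ^ 2 * W) := by gcongr
      _ ≤ 576 * (1 / Z ^ 2 * A + (η + 1 / Z) ^ 2 / H ^ 2 * W) := by
        gcongr
        exact le_add_of_nonneg_left (by positivity)
      _ ≤ _ := by
        gcongr
        exact le_add_of_nonneg_left (by positivity)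
  obtain ⟨κ, hκc, hκi, hκ, hκt, hrep⟩ := hker Y hY
  set J := Set.Icc (Real.exp (-4) * Y) (Real.exp 4 * Y) with hJ
  set T := ∑ n ∈ N, ‖f n‖ with hT
  have hT0 : 0 ≤ T := Finset.sum_nonneg fun _ _ => norm_nonneg _
  set G : ℝ → ℂ := fun ξ => dirPoly f (1 / 2 + Complex.I * ((-(2 * π * ξ) : ℝ) : ℂ)) with hG
  have hGc : Continuous G := (continuous_dirPoly_line hN h0).comp
    (by fun_prop : Continuous fun ξ : ℝ => -(2 * π * ξ))
  have hGn : ∀ ξ, ‖G ξ‖ ≤ T / √X :=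
    norm_dirPoly_half_line_le hX (fun n hn => (hf n hn).1) hN
  have hcR := continuous_eR
  set B : ℝ → ℂ := fun ξ => κ ξ * G ξ * eR (ξ * Real.log (β / Y)) with hB
  have hBc : Continuous B := by fun_prop
  have hBn : ∀ ξ, ‖B ξ‖ ≤ ‖κ ξ‖ * (T / √X) := fun ξ => by
    simp only [hB, norm_mul, norm_eR, mul_one]
    exact mul_le_mul_of_nonneg_left (hGn ξ) (norm_nonneg _)
  have hBi : Integrable B := (hκi.norm.mul_const (T / √X)).mono' hBc.aestronglyMeasurable
    (Filter.Eventually.of_forall hBn)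
  set h : ℝ → ℝ := fun w => ‖∫ ξ in J, B ξ * eR (w * ξ)‖ ^ 2 with hh
  have hhc : Continuous h := (continuous_integral_mul_eR hBi.integrableOn).norm.pow 2
  have htail : ∀ w : ℝ, ‖∫ ξ in Jᶜ, B ξ * eR (w * ξ)‖ ≤ C / Y * (T / √X) := fun w => by
    refine (norm_integral_le_integral_norm _).trans ?_
    calc ∫ ξ in Jᶜ, ‖B ξ * eR (w * ξ)‖ ≤ ∫ ξ in Jᶜ, ‖κ ξ‖ * (T / √X) := by
          refine integral_mono (integrable_mul_eR hBi.integrableOn (by fun_prop)).norm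
            (hκi.norm.mul_const _).integrableOn fun ξ => ?_
          simp only [norm_mul (B ξ), norm_eR, mul_one]
          exact hBn ξ
      _ ≤ _ := by
        rw [integral_mul_const]
        gcongr
  have hδβ : 1 / H ≤ β / 2 := by
    rw [div_le_iff₀ hH]
    linarith
  have hδ : 0 < 1 / H := by positivity
  have hpt : ∀ θ ∈ Set.Icc (β - 1 / H) (β + 1 / H), ‖expSumR f θ‖ ^ 2 ≤
      2 * Y * (h (Real.log (θ / β)) * θ⁻¹) + 4 * X * (C / Y * (T / √X)) ^ 2 := by
    intro θ hθ
    have hθ1 : β / 2 ≤ θ := by linarith [hθ.1]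
    have hθ2 : θ ≤ 3 * β / 2 := by linarith [hθ.2]
    have hθ0 : 0 < θ := by linarith
    have hS := expSumR_eq_integral_kernel hX hY (fun n hn => (hf n hn).1) hN hκi hrep hθ0
      fun n hn => by
        obtain ⟨hn1, hn2⟩ := hf n hn
        constructor
        · calc Y / 2 = β / 2 * X := by rw [hYdef]; ring
            _ ≤ θ * n := by gcongr
        · calc θ * n ≤ 3 * β / 2 * (2 * X) := by gcongr
            _ = 3 * Y := by rw [hYdef]; ring
    have hlog : Real.log (θ / Y) = Real.log (β / Y) + Real.log (θ / β) := by
      rw [← Real.log_mul (by positivity) (by positivity)]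
      congr 1
      field_simp
    have hS2 : expSumR f θ = ((√(Y / θ) : ℝ) : ℂ) * ((∫ ξ in J, B ξ * eR (Real.log (θ / β) * ξ)) +
        ∫ ξ in Jᶜ, B ξ * eR (Real.log (θ / β) * ξ)) := by
      rw [hS, integral_add_compl measurableSet_Icc (integrable_mul_eR hBi (by fun_prop))]
      congr 1
      refine integral_congr_ae (Filter.Eventually.of_forall fun ξ => ?_)
      simp only [hB, hG, hlog, mul_add, eR_add]
      rw [mul_comm (Real.log (θ / β)) ξ]
      ring
    have hYθ : Y / θ ≤ 2 * X := by
      rw [div_le_iff₀ hθ0, hYdef]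
      nlinarith
    rw [hS2, norm_mul, mul_pow, Complex.norm_real, Real.norm_of_nonneg (Real.sqrt_nonneg _),
      Real.sq_sqrt (by positivity)]
    set a := ∫ ξ in J, B ξ * eR (Real.log (θ / β) * ξ) with ha
    have hb := htail (Real.log (θ / β))
    set b := ∫ ξ in Jᶜ, B ξ * eR (Real.log (θ / β) * ξ) with hb'
    calc Y / θ * ‖a + b‖ ^ 2 ≤ Y / θ * (2 * ‖a‖ ^ 2 + 2 * ‖b‖ ^ 2) := by
          gcongr
          have h1 := norm_add_le a b
          have h2 := norm_nonneg (a + b)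
          nlinarith [sq_nonneg (‖a‖ - ‖b‖)]
      _ = 2 * Y * (‖a‖ ^ 2 * θ⁻¹) + Y / θ * (2 * ‖b‖ ^ 2) := by ring
      _ ≤ 2 * Y * (‖a‖ ^ 2 * θ⁻¹) + 2 * X * (2 * (C / Y * (T / √X)) ^ 2) := by gcongr
      _ = _ := by
        simp only [hh, ha]
        ring
  have hhi : IntervalIntegrable (fun θ => h (Real.log (θ / β)) * θ⁻¹) volume
      (β - 1 / H) (β + 1 / H) := by
    have hpos : ∀ θ ∈ Set.uIcc (β - 1 / H) (β + 1 / H), θ ≠ 0 := fun θ hθ => by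
      rw [Set.uIcc_of_le (by linarith)] at hθ
      exact (by linarith [hθ.1] : 0 < θ).ne'
    refine ContinuousOn.intervalIntegrable (ContinuousOn.mul ?_ (continuousOn_inv₀.mono hpos))
    exact hhc.comp_continuousOn (Real.continuousOn_log.comp
      (continuous_id.div_const β).continuousOn fun θ hθ => div_ne_zero (hpos θ hθ) hβ.ne')
  have hSc : Continuous fun θ => ‖expSumR f θ‖ ^ 2 := by
    simp only [expSumR_eq_sum hN]
    fun_prop
  have hint := intervalIntegral.integral_mono_on (by linarith) (hSc.intervalIntegrable _ _)
    ((hhi.const_mul (2 * Y)).add (intervalIntegrable_const (c := 4 * X * (C / Y * (T / √X)) ^ 2)))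
    hpt
  refine hint.trans ?_
  rw [intervalIntegral.integral_add (hhi.const_mul _) intervalIntegrable_const,
    intervalIntegral.integral_const_mul, intervalIntegral.integral_const, smul_eq_mul]
  have hm1 := integral_comp_log_div_le hhc (fun _ => sq_nonneg _) hβ hδ hδβ
  have hm2 := integral_sq_main_le hN h0 hκc hκ hH hβ hZY hη hη'
  have hm := hm1.trans hm2
  have hTW := sq_sum_norm_le hH hHX hf hN h0
  have hmain : 2 * Y * ∫ θ in (β - 1 / H)..(β + 1 / H), h (Real.log (θ / β)) * θ⁻¹ ≤
      8 * C ^ 2 / q ^ 2 * (1 / Z ^ 2 * A) := by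
    calc _ ≤ 2 * Y * (4 / (q * Z) ^ 2 * (C ^ 2 / Y * A)) := by gcongr
      _ = _ := by
        field_simp
        ring
  have herr : (β + 1 / H - (β - 1 / H)) * (4 * X * (C / Y * (T / √X)) ^ 2) ≤
      16 * C ^ 2 * ((η + 1 / Z) ^ 2 / H ^ 2 * W) := by
    calc (β + 1 / H - (β - 1 / H)) * (4 * X * (C / Y * (T / √X)) ^ 2)
        = 8 * C ^ 2 / (H * Y ^ 2) * T ^ 2 := by
          rw [mul_pow, div_pow T, Real.sq_sqrt hX.le]
          field_simp
          ring
      _ ≤ 8 * C ^ 2 / (H * Y ^ 2) * (2 * X / H ^ 2 * W) := by gcongr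
      _ = 16 * C ^ 2 * ((1 / (Z * Y)) / H ^ 2 * W) := by
        rw [hYdef, hZdef]
        field_simp
        ring
      _ ≤ 16 * C ^ 2 * ((1 / (Z * Z)) / H ^ 2 * W) := by gcongr
      _ = 16 * C ^ 2 * ((0 + 1 / Z) ^ 2 / H ^ 2 * W) := by
        ring
      _ ≤ _ := by gcongr
  have hA1 : 0 ≤ 1 / Z ^ 2 * A := by positivity
  have hW1 : 0 ≤ (η + 1 / Z) ^ 2 / H ^ 2 * W := by positivity
  have c1 : 0 ≤ 8 * C ^ 2 / q ^ 2 := by positivity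
  have c2 : 0 ≤ 16 * C ^ 2 := by positivity
  have d1 := mul_nonneg c1 hW1
  have d2 := mul_nonneg c2 hA1
  linarith

lemma expSumR_conj_neg (f : ℕ → ℂ) (N : Finset ℕ) (hN : ∀ n, f n ≠ 0 → n ∈ N) (θ : ℝ) :
    expSumR (fun n => (starRingEnd ℂ) (f n)) (-θ) = (starRingEnd ℂ) (expSumR f θ) := by
  rw [expSumR_eq_sum hN, expSumR_eq_sum (N := N) (fun n hn => hN n fun h => hn (by simp [h])),
    map_sum]
  refine Finset.sum_congr rfl fun n _ => ?_
  rw [map_mul, conj_eR, neg_mul]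

lemma dirPoly_conj (f : ℕ → ℂ) (N : Finset ℕ) (hN : ∀ n, f n ≠ 0 → n ∈ N) (s : ℂ) :
    dirPoly (fun n => (starRingEnd ℂ) (f n)) ((starRingEnd ℂ) s) =
      (starRingEnd ℂ) (dirPoly f s) := by
  rw [dirPoly_eq_sum hN, dirPoly_eq_sum (N := N) (fun n hn => hN n fun h => hn (by simp [h])),
    map_sum]
  refine Finset.sum_congr rfl fun n _ => ?_
  rw [map_div₀, Complex.cpow_conj _ _ (by simp [Complex.natCast_arg, Real.pi_ne_zero.symm]),
    Complex.conj_natCast]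

/-- **Stationary phase bound for short `L²` averages of exponential sums (generic `β`).** -/
theorem stationary_phase_generic :
    ∃ c C : ℝ, 0 < c ∧ c < 1 ∧ 0 < C ∧
    ∀ H X : ℝ, 1 ≤ H → H ≤ X →
    ∀ f : ℕ → ℂ, (∀ n : ℕ, f n ≠ 0 → X < (n : ℝ) ∧ (n : ℝ) ≤ 2 * X) →
    ∀ β η : ℝ, β ≠ 0 → 0 < η → η ≤ c → |β| ≤ c * η →
      (∫ θ in (β - 1 / H)..(β + 1 / H), ‖expSumR f θ‖ ^ 2)
        ≤ C * ((1 / (|β| ^ 2 * H ^ 2)) *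
              (∫ t in {t : ℝ | η * |β| * X ≤ |t| ∧ |t| ≤ |β| * X / η},
                (∫ t' in (t - |β| * H)..(t + |β| * H),
                  ‖dirPoly f (1 / 2 + Complex.I * (t' : ℂ))‖) ^ 2)
            + ((η + 1 / (|β| * H)) ^ 2 / H ^ 2) *
              (∫ x : ℝ, (∑ n ∈ Finset.Icc ⌈x⌉₊ ⌊x + H⌋₊, ‖f n‖) ^ 2)) := by
  obtain ⟨C, hC, hpos⟩ := stationary_phase_pos
  refine ⟨Real.exp (-4) / 10, C, by positivity, ?_, hC, ?_⟩
  · have : Real.exp (-4) ≤ 1 := Real.exp_le_one_iff.2 (by norm_num)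
    linarith
  intro H X hH hHX f hf β η hβ hη hη' _
  rcases lt_or_gt_of_ne hβ with hneg | hβ0
  swap
  · simpa only [abs_of_pos hβ0] using hpos H X hH hHX f hf β η hβ0 hη hη'
  have hN : ∀ n, f n ≠ 0 → n ∈ Finset.range (⌊2 * X⌋₊ + 1) := fun n hn =>
    Finset.mem_range_succ_iff.2 (Nat.le_floor (hf n hn).2)
  set g : ℕ → ℂ := fun n => (starRingEnd ℂ) (f n) with hg
  have h := hpos H X hH hHX g (fun n hn => hf n fun h => hn (by simp [hg, h])) (-β) η
    (neg_pos.2 hneg) hη hη'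
  rw [abs_of_neg hneg]
  have hgn : ∀ n, ‖g n‖ = ‖f n‖ := fun n => Complex.norm_conj _
  have e1 : ∫ θ in (-β - 1 / H)..(-β + 1 / H), ‖expSumR g θ‖ ^ 2 =
      ∫ θ in (β - 1 / H)..(β + 1 / H), ‖expSumR f θ‖ ^ 2 := by
    have e : -β - 1 / H = -(β + 1 / H) ∧ -β + 1 / H = -(β - 1 / H) := ⟨by ring, by ring⟩
    rw [e.1, e.2, ← intervalIntegral.integral_comp_neg]
    simp only [hg, expSumR_conj_neg f _ hN, Complex.norm_conj]
  have hd : ∀ t : ℝ, ‖dirPoly g (1 / 2 + Complex.I * (t : ℂ))‖ =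
      ‖dirPoly f (1 / 2 + Complex.I * ((-t : ℝ) : ℂ))‖ := fun t => by
    rw [← Complex.norm_conj (dirPoly f _), ← dirPoly_conj f _ hN]
    congr 2
    simp [map_ofNat]
  have e2 : ∀ t, ∫ t' in (t - -β * H)..(t + -β * H), ‖dirPoly g (1 / 2 + Complex.I * (t' : ℂ))‖ =
      ∫ t' in (-t - -β * H)..(-t + -β * H), ‖dirPoly f (1 / 2 + Complex.I * (t' : ℂ))‖ := by
    intro t
    have e : -t - -β * H = -(t + -β * H) ∧ -t + -β * H = -(t - -β * H) := ⟨by ring, by ring⟩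
    rw [e.1, e.2, ← intervalIntegral.integral_comp_neg]
    simp only [hd]
  have hIm : MeasurableSet {t : ℝ | η * -β * X ≤ |t| ∧ |t| ≤ -β * X / η} :=
    ((isClosed_le continuous_const continuous_abs).inter
      (isClosed_le continuous_abs continuous_const)).measurableSet
  have e3 : ∀ Q : ℝ → ℝ, ∫ t in {t : ℝ | η * -β * X ≤ |t| ∧ |t| ≤ -β * X / η}, Q (-t) =
      ∫ t in {t : ℝ | η * -β * X ≤ |t| ∧ |t| ≤ -β * X / η}, Q t := by
    intro Q
    rw [← integral_indicator hIm, ← integral_indicator hIm, ← integral_neg_eq_self]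
    congr 1
    ext t
    simp [Set.indicator_apply]
  simp only [e1, e2, hgn] at h
  rwa [e3 fun t => (∫ t' in (t - -β * H)..(t + -β * H),
    ‖dirPoly f (1 / 2 + Complex.I * (t' : ℂ))‖) ^ 2] at h
end
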